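/- Let 0 < α < 1 and 1 < p < ∞. There exists a constant c > 0 (depending only on α and p) such that for every f in the Hölder class Λ_α(ℝ²) and all bounded normal operators N₁, N₂ on a complex Hilbert space H with N₁ − N₂ in the Schatten class S_p, the operator f(N₁) − f(N₂) belongs to S_{p/α} and ‖f(N₁) − f(N₂)‖_{S_{p/α}} ≤ c · ‖f‖_{Λ_α} · ‖N₁ − N₂‖_{S_p}^α. -/

import Mathlib

/-- The `j`-th singular value (approximation number) of a bounded operator `T`:
the distance from `T` to the operators of rank at most `j`. -/
noncomputable def sNum {H : Type*} [NormedAddCommGroup H] [InnerProductSpace ℂ H]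
    (T : H →L[ℂ] H) (j : ℕ) : ℝ :=
  sInf {c : ℝ | ∃ R : H →L[ℂ] H, LinearMap.rank (R : H →ₗ[ℂ] H) ≤ j ∧ c = ‖T - R‖}

/-- `T` belongs to the Schatten–von Neumann class `S_q`. -/
def MemSchatten {H : Type*} [NormedAddCommGroup H] [InnerProductSpace ℂ H]
    (q : ℝ) (T : H →L[ℂ] H) : Prop :=
  Summable fun j : ℕ => sNum T j ^ q

/-- The Schatten `S_q` norm `(Σ_j s_j(T)^q)^{1/q}`. -/
noncomputable def schattenNorm {H : Type*} [NormedAddCommGroup H] [InnerProductSpace ℂ H]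
    (q : ℝ) (T : H →L[ℂ] H) : ℝ :=
  (∑' j : ℕ, sNum T j ^ q) ^ (1 / q)

open scoped InnerProductSpace

section KyFan

variable {H : Type*} [NormedAddCommGroup H] [InnerProductSpace ℂ H]

/-- The functional `T ↦ tr (Y* T X)` for `X Y : ℂ^m → H`. -/
noncomputable def kyPair {m : ℕ} (X Y : EuclideanSpace ℂ (Fin m) →L[ℂ] H) :
    (H →L[ℂ] H) →L[ℂ] ℂ :=
  ∑ i, (innerSL ℂ (Y (EuclideanSpace.basisFun (Fin m) ℂ i))) ∘L
    (ContinuousLinearMap.apply ℂ H (X (EuclideanSpace.basisFun (Fin m) ℂ i)))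

lemma kyPair_apply {m : ℕ} (X Y : EuclideanSpace ℂ (Fin m) →L[ℂ] H) (T : H →L[ℂ] H) :
    kyPair X Y T = ∑ i, ⟪Y (EuclideanSpace.basisFun (Fin m) ℂ i),
      T (X (EuclideanSpace.basisFun (Fin m) ℂ i))⟫_ℂ := by
  simp [kyPair]

/-- `C` is a bound for the Ky Fan norm `∑_{i<m} s_i(T)`, expressed by duality. -/
def KyFanLE (m : ℕ) (T : H →L[ℂ] H) (C : ℝ) : Prop :=
  ∀ X Y : EuclideanSpace ℂ (Fin m) →L[ℂ] H, ‖kyPair X Y T‖ ≤ C * ‖X‖ * ‖Y‖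

variable {m : ℕ} {S T : H →L[ℂ] H} {C D : ℝ}

lemma KyFanLE.mono (h : KyFanLE m T C) (hCD : C ≤ D) : KyFanLE m T D := fun X Y =>
  (h X Y).trans (by gcongr)

lemma KyFanLE.zero : KyFanLE m (0 : H →L[ℂ] H) 0 := fun X Y => by simp

lemma KyFanLE.add (hS : KyFanLE m S C) (hT : KyFanLE m T D) : KyFanLE m (S + T) (C + D) :=
  fun X Y => by
    rw [map_add, add_mul, add_mul]
    exact norm_add_le_of_le (hS X Y) (hT X Y)

lemma KyFanLE.smul (c : ℂ) (hT : KyFanLE m T C) : KyFanLE m (c • T) (‖c‖ * C) :=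
  fun X Y => by
    rw [map_smul, norm_smul, mul_assoc, mul_assoc, ← mul_assoc C]
    gcongr
    exact hT X Y

lemma KyFanLE.neg (hT : KyFanLE m T C) : KyFanLE m (-T) C :=
  fun X Y => by
    rw [map_neg, norm_neg]
    exact hT X Y

lemma KyFanLE.sub (hS : KyFanLE m S C) (hT : KyFanLE m T D) : KyFanLE m (S - T) (C + D) := by
  rw [sub_eq_add_neg]
  exact hS.add hT.neg

lemma KyFanLE.sum {ι : Type*} (s : Finset ι) {F : ι → H →L[ℂ] H} {c : ι → ℝ}
    (h : ∀ i ∈ s, KyFanLE m (F i) (c i)) : KyFanLE m (∑ i ∈ s, F i) (∑ i ∈ s, c i) :=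
  fun X Y => by
    rw [map_sum, Finset.sum_mul, Finset.sum_mul]
    exact norm_sum_le_of_le _ fun i hi => h i hi X Y

lemma KyFanLE.of_norm_le (h : ‖T‖ ≤ C) : KyFanLE m T (m * C) := fun X Y => by
  rw [kyPair_apply]
  have h1 : ∀ i ∈ (Finset.univ : Finset (Fin m)), ‖⟪Y (EuclideanSpace.basisFun (Fin m) ℂ i),
      T (X (EuclideanSpace.basisFun (Fin m) ℂ i))⟫_ℂ‖ ≤ C * ‖X‖ * ‖Y‖ := by
    intro i _
    have hX := X.le_opNorm (EuclideanSpace.basisFun (Fin m) ℂ i)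
    have hY := Y.le_opNorm (EuclideanSpace.basisFun (Fin m) ℂ i)
    rw [OrthonormalBasis.norm_eq_one, mul_one] at hX hY
    have hC : 0 ≤ C := (norm_nonneg _).trans h
    calc _ ≤ ‖Y (EuclideanSpace.basisFun (Fin m) ℂ i)‖
          * ‖T (X (EuclideanSpace.basisFun (Fin m) ℂ i))‖ := norm_inner_le_norm _ _
      _ ≤ ‖Y‖ * (C * ‖X‖) := by
        gcongr
        exact (T.le_opNorm _).trans (by gcongr)
      _ = _ := by ring
  refine (norm_sum_le_of_le _ h1).trans (le_of_eq ?_)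
  simp
  ring

/-- Ky Fan bounds pass to limits in the operator norm. -/
lemma KyFanLE.of_tendsto {F : ℕ → H →L[ℂ] H} {c : ℕ → ℝ}
    (hF : Filter.Tendsto F Filter.atTop (nhds T)) (hc : Filter.Tendsto c Filter.atTop (nhds C))
    (h : ∀ᶠ k in Filter.atTop, KyFanLE m (F k) (c k)) : KyFanLE m T C := fun X Y => by
  have h1 := (((kyPair X Y).continuous.tendsto T).comp hF).norm
  refine le_of_tendsto_of_tendsto h1 ((hc.mul_const ‖X‖).mul_const ‖Y‖) ?_
  filter_upwards [h] with k hk using hk X Y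

/-- Averaging over signs: a diagonal sum is controlled by the full sums with random signs. -/
lemma KyFanLE.sum_mul_mul_of_signs {ι : Type*} (s : Finset ι) (a b : ι → H →L[ℂ] H) (E : H →L[ℂ] H)
    (A B : H →L[ℂ] H)
    (h : ∀ ε : ι → ℂ, (∀ i, ‖ε i‖ ≤ 1) →
      KyFanLE m ((A + ∑ i ∈ s, ε i • a i) * E * (B + ∑ i ∈ s, ε i • b i)) C) :
    KyFanLE m (A * E * B + ∑ i ∈ s, a i * E * b i) C := by
  classical
  induction s using Finset.induction_on generalizing A B with
  | empty => simpa using h 0 (by simp)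
  | insert n s hn ih =>
    have key : ∀ σ : ℂ, ‖σ‖ ≤ 1 → KyFanLE m
        ((A + σ • a n) * E * (B + σ • b n) + ∑ i ∈ s, a i * E * b i) C := by
      intro σ hσ
      refine ih _ _ fun ε hε => ?_
      have h1 := h (Function.update ε n σ) fun i => by
        rcases eq_or_ne i n with rfl | hi
        · simpa using hσ
        · simpa [hi] using hε i
      have h2 : ∀ x : ι → H →L[ℂ] H, ∑ i ∈ s, Function.update ε n σ i • x i =
          ∑ i ∈ s, ε i • x i := fun x => Finset.sum_congr rfl fun i hi => by
        rw [Function.update_of_ne (ne_of_mem_of_not_mem hi hn)]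
      rw [Finset.sum_insert hn, Finset.sum_insert hn, h2, h2, Function.update_self] at h1
      simpa only [add_assoc] using h1
    have h1 := ((key 1 (by simp)).add (key (-1) (by simp))).smul (1 / 2)
    convert h1 using 1
    · rw [Finset.sum_insert hn]
      simp only [one_smul, neg_smul, add_mul, mul_add, neg_mul, mul_neg, smul_add, smul_neg]
      module
    · norm_num
      ring

variable [CompleteSpace H]

lemma KyFanLE.mul (hT : KyFanLE m T C) (A B : H →L[ℂ] H) {a b : ℝ} (hA : ‖A‖ ≤ a) (hB : ‖B‖ ≤ b)
    (hC : 0 ≤ C) : KyFanLE m (A * T * B) (a * b * C) := fun X Y => by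
  have key : kyPair X Y (A * T * B) = kyPair (B ∘L X) (ContinuousLinearMap.adjoint A ∘L Y) T := by
    simp [kyPair_apply, ContinuousLinearMap.adjoint_inner_left]
  rw [key]
  have h2 : ‖ContinuousLinearMap.adjoint A ∘L Y‖ ≤ a * ‖Y‖ :=
    (ContinuousLinearMap.opNorm_comp_le _ _).trans (by
      rw [LinearIsometryEquiv.norm_map]; gcongr)
  have h3 : ‖B ∘L X‖ ≤ b * ‖X‖ :=
    (ContinuousLinearMap.opNorm_comp_le _ _).trans (by gcongr)
  have ha : 0 ≤ a := (norm_nonneg _).trans hA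
  have hb : 0 ≤ b := (norm_nonneg _).trans hB
  calc _ ≤ C * ‖B ∘L X‖ * ‖ContinuousLinearMap.adjoint A ∘L Y‖ := hT _ _
    _ ≤ C * (b * ‖X‖) * (a * ‖Y‖) := by gcongr
    _ = _ := by ring

lemma KyFanLE.star_right (hT : KyFanLE m T C) : KyFanLE m (Star.star T) C := fun X Y => by
  have key : kyPair X Y (Star.star T) = starRingEnd ℂ (kyPair Y X T) := by
    simp [kyPair_apply, ContinuousLinearMap.star_eq_adjoint,
      ContinuousLinearMap.adjoint_inner_right]
  rw [key, RCLike.norm_conj, mul_right_comm]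
  exact hT Y X

end KyFan

section SingularNumbers

variable {H : Type*} [NormedAddCommGroup H] [InnerProductSpace ℂ H]

lemma sNum_le {T R : H →L[ℂ] H} {j : ℕ} (hR : LinearMap.rank (R : H →ₗ[ℂ] H) ≤ j) :
    sNum T j ≤ ‖T - R‖ :=
  csInf_le ⟨0, by rintro c ⟨R, -, rfl⟩; exact norm_nonneg _⟩ ⟨R, hR, rfl⟩

lemma le_sNum {T : H →L[ℂ] H} {j : ℕ} {a : ℝ}
    (h : ∀ R : H →L[ℂ] H, LinearMap.rank (R : H →ₗ[ℂ] H) ≤ j → a ≤ ‖T - R‖) : a ≤ sNum T j := by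
  refine le_csInf ⟨‖T - 0‖, 0, ?_, rfl⟩ ?_
  · simp
  · rintro c ⟨R, hR, rfl⟩
    exact h R hR

lemma sNum_nonneg (T : H →L[ℂ] H) (j : ℕ) : 0 ≤ sNum T j := le_sNum fun _ _ => norm_nonneg _

lemma sNum_antitone (T : H →L[ℂ] H) : Antitone (sNum T) := fun _ _ hij =>
  le_sNum fun _ hR => sNum_le (hR.trans (by exact_mod_cast hij))

end SingularNumbers

section SingularNumbersKyFan

variable {H : Type*} [NormedAddCommGroup H] [InnerProductSpace ℂ H] [CompleteSpace H]

lemma kyPair_eq_sum {m : ℕ} (X Y : EuclideanSpace ℂ (Fin m) →L[ℂ] H) (T : H →L[ℂ] H)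
    (b : OrthonormalBasis (Fin m) ℂ (EuclideanSpace ℂ (Fin m))) :
    kyPair X Y T = ∑ i, ⟪Y (b i), T (X (b i))⟫_ℂ := by
  have h := fun b : OrthonormalBasis (Fin m) ℂ (EuclideanSpace ℂ (Fin m)) =>
    LinearMap.trace_eq_sum_inner
      ((ContinuousLinearMap.adjoint Y ∘L T ∘L X : _ →L[ℂ] _) :
        EuclideanSpace ℂ (Fin m) →ₗ[ℂ] EuclideanSpace ℂ (Fin m)) b
  have h1 := (h (EuclideanSpace.basisFun (Fin m) ℂ)).symm.trans (h b)
  simpa [kyPair_apply, ContinuousLinearMap.adjoint_inner_right] using h1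

/-- In an orthonormal eigenbasis of `Z* Z`, ordered decreasingly, the norm of a combination of the
first `i + 1` vectors is at least `‖Z b_i‖` times the norm of the combination. -/
lemma exists_orthonormalBasis_norm_le {m : ℕ} (Z : EuclideanSpace ℂ (Fin m) →L[ℂ] H) :
    ∃ b : OrthonormalBasis (Fin m) ℂ (EuclideanSpace ℂ (Fin m)),
      ∀ (i : Fin m) (v : EuclideanSpace ℂ (Fin m)), (∀ k, i < k → b.repr v k = 0) →
        ‖Z (b i)‖ * ‖v‖ ≤ ‖Z v‖ := by
  set Q : EuclideanSpace ℂ (Fin m) →ₗ[ℂ] EuclideanSpace ℂ (Fin m) :=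
    ((ContinuousLinearMap.adjoint Z ∘L Z : _ →L[ℂ] _) :
        EuclideanSpace ℂ (Fin m) →ₗ[ℂ] EuclideanSpace ℂ (Fin m)) with hQ
  have hQv : ∀ v w, ⟪v, Q w⟫_ℂ = ⟪Z v, Z w⟫_ℂ := by
    intro v w
    simp [hQ, ContinuousLinearMap.adjoint_inner_right]
  have hsym : Q.IsSymmetric := by
    intro v w
    rw [hQv, ← inner_conj_symm, hQv, inner_conj_symm]
  have hn : Module.finrank ℂ (EuclideanSpace ℂ (Fin m)) = m := by simp
  set b := hsym.eigenvectorBasis hn with hb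
  set ev := hsym.eigenvalues hn with hev
  have hnorm : ∀ v, ‖Z v‖ ^ 2 = ∑ k, ev k * ‖b.repr v k‖ ^ 2 := by
    intro v
    have h1 : ((‖Z v‖ ^ 2 : ℝ) : ℂ) = ⟪v, Q v⟫_ℂ := by
      rw [hQv, inner_self_eq_norm_sq_to_K]
      simp
    rw [← OrthonormalBasis.sum_inner_mul_inner b] at h1
    have h2 : ∀ k, ⟪v, b k⟫_ℂ * ⟪b k, Q v⟫_ℂ = ((ev k * ‖b.repr v k‖ ^ 2 : ℝ) : ℂ) := by
      intro k
      rw [← b.repr_apply_apply (Q v), hsym.eigenvectorBasis_apply_self_apply hn,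
        ← inner_conj_symm, ← b.repr_apply_apply v, mul_left_comm, RCLike.conj_mul]
      simp [hev]
    simp_rw [h2] at h1
    exact_mod_cast h1
  have hvn : ∀ v, ‖v‖ ^ 2 = ∑ k, ‖b.repr v k‖ ^ 2 := by
    intro v
    rw [← b.repr.norm_map v, EuclideanSpace.norm_sq_eq]
  refine ⟨b, fun i v hv => ?_⟩
  have hbi : ‖Z (b i)‖ ^ 2 = ev i := by
    rw [hnorm]
    simp [apply_ite]
  refine le_of_sq_le_sq ?_ (norm_nonneg _)
  rw [mul_pow, hbi, hnorm, hvn, Finset.mul_sum]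
  refine Finset.sum_le_sum fun k _ => ?_
  rcases lt_or_ge i k with h | h
  · simp [hv k h]
  · gcongr
    exact hsym.eigenvalues_antitone hn h

lemma kyFanLE_sum_sNum (m : ℕ) (T : H →L[ℂ] H) :
    KyFanLE m T (∑ i ∈ Finset.range m, sNum T i) := by
  intro X Y
  obtain ⟨b, hb⟩ := exists_orthonormalBasis_norm_le (T ∘L X)
  have key : ∀ i : Fin m, ‖T (X (b i))‖ ≤ ‖X‖ * sNum T i := by
    intro i
    rcases eq_or_lt_of_le (norm_nonneg X) with hX0 | hX0
    · have : X = 0 := norm_eq_zero.mp hX0.symm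
      simp [this]
    rw [← div_le_iff₀' hX0]
    refine le_sNum fun R hR => ?_
    -- a vector in the span of the first `i + 1` basis vectors killed by `R ∘ X`
    let J : (Fin (i + 1) → ℂ) →ₗ[ℂ] EuclideanSpace ℂ (Fin m) :=
      Fintype.linearCombination ℂ fun k : Fin (i + 1) => b (Fin.castLE i.2 k)
    have hJ : ∀ c, J c = ∑ k, c k • b (Fin.castLE i.2 k) := fun c =>
      Fintype.linearCombination_apply _ _ _
    have hJinj : Function.Injective J := by
      exact (b.orthonormal.comp _
        (Fin.castLE_injective i.2)).linearIndependent.fintypeLinearCombination_injective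
    have hker : ¬ Function.Injective ((R : H →ₗ[ℂ] H) ∘ₗ (X : _ →ₗ[ℂ] H) ∘ₗ J) := by
      intro hinj
      have h1 := lift_rank_range_of_injective _ hinj
      have h2 := Cardinal.lift_le.{0}.mpr
        ((LinearMap.rank_comp_le_left ((X : _ →ₗ[ℂ] H) ∘ₗ J) (R : H →ₗ[ℂ] H)).trans hR)
      rw [LinearMap.rank, h1, rank_fun'] at h2
      simp at h2
    rw [← LinearMap.ker_eq_bot, Submodule.eq_bot_iff] at hker
    push Not at hker
    obtain ⟨c, hc, hc0⟩ := hker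
    have hRv : R (X (J c)) = 0 := by simpa using hc
    have hv0 : 0 < ‖J c‖ := by
      rw [norm_pos_iff]
      intro h
      exact hc0 (hJinj (by simpa using h))
    have hrep : ∀ k, i < k → b.repr (J c) k = 0 := by
      intro k hk
      rw [hJ, b.repr_apply_apply, inner_sum]
      refine Finset.sum_eq_zero fun l _ => ?_
      rw [inner_smul_right, b.inner_eq_zero, mul_zero]
      intro h
      have h1 := congrArg Fin.val h
      have h2 : (i : ℕ) < k := hk
      simp at h1
      omega
    have h1 := hb i (J c) hrep
    rw [div_le_iff₀' hX0]
    refine le_of_mul_le_mul_right ?_ hv0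
    calc _ ≤ ‖T (X (J c))‖ := h1
      _ = ‖(T - R) (X (J c))‖ := by simp [hRv]
      _ ≤ ‖T - R‖ * (‖X‖ * ‖J c‖) :=
        (ContinuousLinearMap.le_opNorm _ _).trans (by gcongr; exact X.le_opNorm _)
      _ = _ := by ring
  rw [kyPair_eq_sum X Y T b, Finset.sum_range, Finset.sum_mul, Finset.sum_mul]
  refine norm_sum_le_of_le _ fun i _ => (norm_inner_le_norm _ _).trans ?_
  have hY := Y.le_opNorm (b i)
  rw [b.norm_eq_one, mul_one] at hY
  calc _ ≤ ‖Y‖ * (‖X‖ * sNum T i) := by gcongr; exact key i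
    _ = _ := by ring

end SingularNumbersKyFan

section SingularNumbersLower

variable {H : Type*} [NormedAddCommGroup H] [InnerProductSpace ℂ H]

lemma orthonormal_finCons {k : ℕ} {x : Fin k → H} (hx : Orthonormal ℂ x) {u : H} (hu : ‖u‖ = 1)
    (h : ∀ i, ⟪x i, u⟫_ℂ = 0) : Orthonormal ℂ (Fin.cons u x : Fin (k + 1) → H) := by
  refine ⟨fun i => ?_, fun i j hij => ?_⟩
  · refine Fin.cases ?_ (fun i => ?_) i
    · simpa using hu
    · simpa using hx.1 i
  · rcases Fin.eq_zero_or_eq_succ i with rfl | ⟨i, rfl⟩ <;>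
      rcases Fin.eq_zero_or_eq_succ j with rfl | ⟨j, rfl⟩
    · exact absurd rfl hij
    · simpa using inner_eq_zero_symm.mp (h j)
    · simpa using h i
    · simpa using hx.2 (fun hh => hij (congrArg _ hh))

instance hasOrthogonalProjection_span_range_fin {k : ℕ} (x : Fin k → H) :
    (Submodule.span ℂ (Set.range x)).HasOrthogonalProjection :=
  haveI : FiniteDimensional ℂ (Submodule.span ℂ (Set.range x)) :=
    FiniteDimensional.span_of_finite ℂ (Set.finite_range x)
  haveI : CompleteSpace (Submodule.span ℂ (Set.range x)) := FiniteDimensional.complete ℂ _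
  inferInstance

lemma rank_starProjection_span_range_le {k : ℕ} (x : Fin k → H) :
    LinearMap.rank ((Submodule.span ℂ (Set.range x)).starProjection : H →ₗ[ℂ] H) ≤ k := by
  have h1 : LinearMap.range ((Submodule.span ℂ (Set.range x)).starProjection : H →ₗ[ℂ] H) ≤
      Submodule.span ℂ (Set.range x) := by
    rintro _ ⟨v, rfl⟩
    exact Submodule.starProjection_apply_mem _ _
  refine (Submodule.rank_mono h1).trans ((rank_span_le _).trans ?_)
  simpa using Cardinal.mk_range_le_lift (f := x)

lemma exists_orthonormal_le_re_inner (T : H →L[ℂ] H) {t : ℝ} (ht0 : 0 ≤ t) (k : ℕ)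
    (ht : ∀ i < k, t < sNum T (2 * i)) :
    ∃ x y : Fin k → H, Orthonormal ℂ x ∧ Orthonormal ℂ y ∧ ∀ i, t ≤ (⟪y i, T (x i)⟫_ℂ).re := by
  induction k with
  | zero => exact ⟨Fin.elim0, Fin.elim0, ⟨fun i => i.elim0, fun i => i.elim0⟩,
      ⟨fun i => i.elim0, fun i => i.elim0⟩, fun i => i.elim0⟩
  | succ k ih =>
    obtain ⟨x, y, hx, hy, hxy⟩ := ih fun i hi => ht i (by omega)
    set P := (Submodule.span ℂ (Set.range x)).starProjection with hP
    set Q := (Submodule.span ℂ (Set.range y)).starProjection with hQ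
    have hR : LinearMap.rank ((T * P + Q * (T - T * P) : H →L[ℂ] H) : H →ₗ[ℂ] H) ≤
        ((2 * k : ℕ) : Cardinal) := by
      have h1 : ((T * P + Q * (T - T * P) : H →L[ℂ] H) : H →ₗ[ℂ] H) =
          (T : H →ₗ[ℂ] H) ∘ₗ (P : H →ₗ[ℂ] H) +
            (Q : H →ₗ[ℂ] H) ∘ₗ ((T - T * P : H →L[ℂ] H) : H →ₗ[ℂ] H) := rfl
      rw [h1]
      refine (LinearMap.rank_add_le _ _).trans ?_
      have h2 := (LinearMap.rank_comp_le_right (P : H →ₗ[ℂ] H) (T : H →ₗ[ℂ] H)).trans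
        (rank_starProjection_span_range_le x)
      have h3 := (LinearMap.rank_comp_le_left ((T - T * P : H →L[ℂ] H) : H →ₗ[ℂ] H)
        (Q : H →ₗ[ℂ] H)).trans (rank_starProjection_span_range_le y)
      refine (add_le_add h2 h3).trans (le_of_eq ?_)
      push_cast
      ring
    have hlt := (ht k (by omega)).trans_le (sNum_le hR)
    obtain ⟨u, hu1, hu⟩ := ContinuousLinearMap.exists_lt_apply_of_lt_opNorm _ hlt
    set w := u - P u with hw
    have hz : (T - (T * P + Q * (T - T * P))) u = T w - Q (T w) := by
      simp [hw]
      abel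
    rw [hz] at hu
    have hwu : ‖w‖ ≤ 1 := by
      have h1 := Submodule.norm_sq_eq_add_norm_sq_starProjection u (Submodule.span ℂ (Set.range x))
      rw [Submodule.starProjection_orthogonal_val, ← hP, ← hw] at h1
      nlinarith [norm_nonneg w, norm_nonneg u, sq_nonneg ‖P u‖]
    have hw0 : 0 < ‖w‖ := by
      rw [norm_pos_iff]
      intro h
      rw [h] at hu
      simp at hu
      linarith
    set v := T w - Q (T w) with hv
    have hv0 : 0 < ‖v‖ := ht0.trans_lt hu
    refine ⟨Fin.cons ((‖w‖⁻¹ : ℂ) • w) x, Fin.cons ((‖v‖⁻¹ : ℂ) • v) y,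
      orthonormal_finCons hx ?_ ?_, orthonormal_finCons hy ?_ ?_, ?_⟩
    · rw [norm_smul]
      simp [hw0.ne']
    · intro i
      rw [inner_smul_right, Submodule.inner_right_of_mem_orthogonal
        (Submodule.subset_span (Set.mem_range_self i))
        (Submodule.sub_starProjection_mem_orthogonal u), mul_zero]
    · rw [norm_smul]
      simp [hv0.ne']
    · intro i
      rw [inner_smul_right, Submodule.inner_right_of_mem_orthogonal
        (Submodule.subset_span (Set.mem_range_self i))
        (Submodule.sub_starProjection_mem_orthogonal (T w)), mul_zero]
    · intro i
      refine Fin.cases ?_ (fun i => by simpa using hxy i) i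
      have h1 : ⟪v, T w⟫_ℂ = ((‖v‖ ^ 2 : ℝ) : ℂ) := by
        have h2 : ⟪v, Q (T w)⟫_ℂ = 0 :=
          Submodule.inner_left_of_mem_orthogonal (Submodule.starProjection_apply_mem _ _)
            (Submodule.sub_starProjection_mem_orthogonal (T w))
        have h3 : T w = v + Q (T w) := by rw [hv]; abel
        conv_lhs => rw [h3]
        rw [inner_add_right, h2, add_zero, inner_self_eq_norm_sq_to_K]
        simp
      have h4 : ⟪((‖v‖⁻¹ : ℂ) • v), T ((‖w‖⁻¹ : ℂ) • w)⟫_ℂ = ((‖v‖ / ‖w‖ : ℝ) : ℂ) := by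
        rw [map_smul, inner_smul_left, inner_smul_right, h1]
        have : (‖v‖ : ℂ) ≠ 0 := by exact_mod_cast hv0.ne'
        push_cast
        simp
        field_simp
      simp only [Fin.cons_zero]
      rw [h4, Complex.ofReal_re, le_div_iff₀ hw0]
      nlinarith

lemma KyFanLE.mul_sNum_le {m : ℕ} {T : H →L[ℂ] H} {C : ℝ} (h : KyFanLE m T C) (hC : 0 ≤ C) :
    m * sNum T (2 * (m - 1)) ≤ C := by
  rcases Nat.eq_zero_or_pos m with rfl | hm
  · simpa using hC
  have hm' : (0 : ℝ) < m := by exact_mod_cast hm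
  rw [← le_div_iff₀' hm']
  refine le_of_forall_lt fun t ht => ?_
  rcases lt_or_ge t 0 with h0 | ht0
  · exact h0.trans_le (by positivity)
  obtain ⟨t', htt', ht'⟩ := exists_between ht
  refine htt'.trans_le ?_
  obtain ⟨x, y, hx, hy, hxy⟩ := exists_orthonormal_le_re_inner T (ht0.trans htt'.le) m
    fun i hi => ht'.trans_le (sNum_antitone T (by omega))
  have hext : ∀ x : Fin m → H, Orthonormal ℂ x → ∃ X : EuclideanSpace ℂ (Fin m) →L[ℂ] H,
      ‖X‖ ≤ 1 ∧ ∀ i, X (EuclideanSpace.basisFun (Fin m) ℂ i) = x i := by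
    intro x hx
    set b := (EuclideanSpace.basisFun (Fin m) ℂ).toBasis
    have hb : Orthonormal ℂ b := by
      simp [b]
    have hf : Orthonormal ℂ (b.constr ℂ x ∘ b) := by
      convert hx using 1
      ext i
      simp
    refine ⟨((b.constr ℂ x).isometryOfOrthonormal hb hf).toContinuousLinearMap,
      LinearIsometry.norm_toContinuousLinearMap_le _, fun i => ?_⟩
    have : EuclideanSpace.basisFun (Fin m) ℂ i = b i := by simp [b]
    rw [this]
    simp
  obtain ⟨X, hX, hXi⟩ := hext x hx
  obtain ⟨Y, hY, hYi⟩ := hext y hy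
  rw [le_div_iff₀' hm']
  calc m * t' = ∑ _i : Fin m, t' := by simp
    _ ≤ ∑ i, (⟪y i, T (x i)⟫_ℂ).re := Finset.sum_le_sum fun i _ => hxy i
    _ = (kyPair X Y T).re := by simp only [kyPair_apply, hXi, hYi, Complex.re_sum]
    _ ≤ ‖kyPair X Y T‖ := Complex.re_le_norm _
    _ ≤ C * ‖X‖ * ‖Y‖ := h X Y
    _ ≤ C * 1 * 1 := by gcongr
    _ = C := by ring

end SingularNumbersLower

section Hardy

lemma mul_rpow_sub_one_mul_le {p A X : ℝ} (hp : 1 < p) (hA : 0 ≤ A) (hX : 0 ≤ X) :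
    p * A ^ (p - 1) * X ≤ (p - 1) * A ^ p + X ^ p := by
  have hpq := Real.HolderConjugate.conjExponent hp
  have h := Real.young_inequality_of_nonneg hX (Real.rpow_nonneg hA (p - 1)) hpq
  have hp0 : 0 < p := by linarith
  have hp1 : 0 < p - 1 := by linarith
  rw [← Real.rpow_mul hA] at h
  have h1 : (p - 1) * p.conjExponent = p := by
    rw [Real.conjExponent]
    field_simp
  rw [h1, Real.conjExponent] at h
  calc p * A ^ (p - 1) * X = p * (X * A ^ (p - 1)) := by ring
    _ ≤ p * (X ^ p / p + A ^ p / (p / (p - 1))) := by gcongr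
    _ = _ := by field_simp; ring

/-- **Hardy's inequality** for the averages of a nonnegative sequence (finite form). -/
lemma sum_average_rpow_le {p : ℝ} (hp : 1 < p) {s : ℕ → ℝ} (hs : ∀ i, 0 ≤ s i) (N : ℕ) :
    ∑ m ∈ Finset.range N, ((∑ i ∈ Finset.range (m + 1), s i) / (m + 1 : ℕ)) ^ p ≤
      2 ^ p / (p - 1) * ∑ m ∈ Finset.range N, s m ^ p := by
  set A : ℕ → ℝ := fun m => (∑ i ∈ Finset.range m, s i) / (m : ℕ) with hA
  have hA0 : ∀ m, 0 ≤ A m := fun m =>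
    div_nonneg (Finset.sum_nonneg fun i _ => hs i) (Nat.cast_nonneg m)
  have hAm : ∀ m : ℕ, m * A m = ∑ i ∈ Finset.range m, s i := by
    intro m
    rcases Nat.eq_zero_or_pos m with rfl | hm
    · simp
    · have : (m : ℝ) ≠ 0 := by positivity
      simp only [hA]
      field_simp
  have key : N * A N ^ p + (p - 1) / 2 * ∑ m ∈ Finset.range N, A (m + 1) ^ p ≤
      2 ^ p / 2 * ∑ m ∈ Finset.range N, s m ^ p := by
    induction N with
    | zero => simp
    | succ n ih =>
      rw [Finset.sum_range_succ, Finset.sum_range_succ]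
      have h1 := mul_rpow_sub_one_mul_le hp (hA0 (n + 1)) (hA0 n)
      have h2 := mul_rpow_sub_one_mul_le hp (hA0 (n + 1)) (mul_nonneg zero_le_two (hs n))
      rw [Real.mul_rpow zero_le_two (hs n)] at h2
      have h3 : s n = (n + 1 : ℕ) * A (n + 1) - n * A n := by
        rw [hAm, hAm, Finset.sum_range_succ]; ring
      have h4 : A (n + 1) ^ (p - 1) * A (n + 1) = A (n + 1) ^ p := by
        rcases eq_or_lt_of_le (hA0 (n + 1)) with h | h
        · rw [← h, Real.zero_rpow (by linarith : p ≠ 0), mul_zero]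
        · rw [← Real.rpow_add_one h.ne']
          ring_nf
      have h5 : p * A (n + 1) ^ (p - 1) * s n =
          p * ((n + 1) * A (n + 1) ^ p) - n * (p * A (n + 1) ^ (p - 1) * A n) := by
        rw [h3, ← h4]; push_cast; ring
      have h6 := mul_le_mul_of_nonneg_left h1 (Nat.cast_nonneg (α := ℝ) n)
      push_cast
      nlinarith
  have hp1 : 0 < p - 1 := by linarith
  have h0 : 0 ≤ N * A N ^ p := mul_nonneg (Nat.cast_nonneg N) (Real.rpow_nonneg (hA0 N) p)
  rw [div_mul_eq_mul_div, le_div_iff₀ hp1]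
  change (∑ m ∈ Finset.range N, A (m + 1) ^ p) * (p - 1) ≤ _
  nlinarith

lemma sum_range_two_mul_div_two (g : ℕ → ℝ) (n : ℕ) :
    ∑ j ∈ Finset.range (2 * n), g (j / 2) = 2 * ∑ m ∈ Finset.range n, g m := by
  induction n with
  | zero => simp
  | succ n ih =>
    rw [Finset.sum_range_succ, mul_add, mul_add, mul_one, Finset.sum_range_succ,
      Finset.sum_range_succ, ih, show (2 * n + 1) / 2 = n by omega, show 2 * n / 2 = n by omega]
    ring

lemma memSchatten_of_sNum_le_average {H : Type*} [NormedAddCommGroup H] [InnerProductSpace ℂ H]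
    {α p : ℝ} (hα : 0 < α) (hp : 1 < p) {G K : H →L[ℂ] H} {c M : ℝ} (hc : 0 ≤ c) (hM : 0 ≤ M)
    (hK : MemSchatten p K)
    (h : ∀ m : ℕ, sNum G (2 * m) ≤
      c * M * ((∑ i ∈ Finset.range (m + 1), sNum K i) / (m + 1 : ℕ)) ^ α) :
    MemSchatten (p / α) G ∧ schattenNorm (p / α) G ≤
      (2 * (2 ^ p / (p - 1))) ^ (α / p) * c * M * schattenNorm p K ^ α := by
  have hp1 : 0 < p - 1 := by linarith
  have hp0 : 0 < p := by linarith
  have hq : 0 < p / α := by positivity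
  set A : ℕ → ℝ := fun m => (∑ i ∈ Finset.range (m + 1), sNum K i) / (m + 1 : ℕ) with hA
  have hA0 : ∀ m, 0 ≤ A m := fun m =>
    div_nonneg (Finset.sum_nonneg fun i _ => sNum_nonneg _ _) (Nat.cast_nonneg _)
  have hterm : ∀ j, sNum G j ^ (p / α) ≤ (c * M) ^ (p / α) * A (j / 2) ^ p := by
    intro j
    have h1 : sNum G j ≤ c * M * A (j / 2) ^ α :=
      (sNum_antitone G (by omega : 2 * (j / 2) ≤ j)).trans (h (j / 2))
    calc sNum G j ^ (p / α) ≤ (c * M * A (j / 2) ^ α) ^ (p / α) :=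
          Real.rpow_le_rpow (sNum_nonneg _ _) h1 hq.le
      _ = _ := by
        rw [Real.mul_rpow (by positivity) (Real.rpow_nonneg (hA0 _) _), ← Real.rpow_mul (hA0 _),
          mul_div_cancel₀ _ hα.ne']
  have hpart : ∀ n, ∑ j ∈ Finset.range n, sNum G j ^ (p / α) ≤
      (c * M) ^ (p / α) * (2 * (2 ^ p / (p - 1))) * ∑' j, sNum K j ^ p := by
    intro n
    calc ∑ j ∈ Finset.range n, sNum G j ^ (p / α)
        ≤ ∑ j ∈ Finset.range (2 * n), sNum G j ^ (p / α) :=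
          Finset.sum_le_sum_of_subset_of_nonneg (Finset.range_mono (by omega))
            fun i _ _ => Real.rpow_nonneg (sNum_nonneg _ _) _
      _ ≤ ∑ j ∈ Finset.range (2 * n), (c * M) ^ (p / α) * A (j / 2) ^ p :=
          Finset.sum_le_sum fun j _ => hterm j
      _ = (c * M) ^ (p / α) * (2 * ∑ m ∈ Finset.range n, A m ^ p) := by
          rw [← Finset.mul_sum, sum_range_two_mul_div_two fun m => A m ^ p]
      _ ≤ (c * M) ^ (p / α) * (2 * (2 ^ p / (p - 1) * ∑ m ∈ Finset.range n, sNum K m ^ p)) := by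
          gcongr
          exact sum_average_rpow_le hp (sNum_nonneg K) n
      _ ≤ (c * M) ^ (p / α) * (2 * (2 ^ p / (p - 1) * ∑' m, sNum K m ^ p)) := by
          gcongr
          exact hK.sum_le_tsum _ fun i _ => Real.rpow_nonneg (sNum_nonneg _ _) _
      _ = _ := by ring
  have hnn : ∀ j, 0 ≤ sNum G j ^ (p / α) := fun j => Real.rpow_nonneg (sNum_nonneg _ _) _
  have ht0 : 0 ≤ ∑' j, sNum K j ^ p := tsum_nonneg fun j => Real.rpow_nonneg (sNum_nonneg _ _) _
  refine ⟨summable_of_sum_range_le hnn hpart, ?_⟩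
  have hle := Real.tsum_le_of_sum_range_le hnn hpart
  rw [schattenNorm, schattenNorm, one_div_div, ← Real.rpow_mul ht0]
  calc _ ≤ ((c * M) ^ (p / α) * (2 * (2 ^ p / (p - 1))) * ∑' j, sNum K j ^ p) ^ (α / p) :=
        Real.rpow_le_rpow (tsum_nonneg hnn) hle (by positivity)
    _ = ((c * M) ^ (p / α)) ^ (α / p) * (2 * (2 ^ p / (p - 1))) ^ (α / p) *
        (∑' j, sNum K j ^ p) ^ (α / p) := by
        rw [Real.mul_rpow (by positivity) ht0, Real.mul_rpow (by positivity) (by positivity)]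
    _ = _ := by
        rw [← Real.rpow_mul (by positivity), show p / α * (α / p) = 1 by field_simp, Real.rpow_one,
          show 1 / p * α = α / p by ring]
        ring

end Hardy

section Localization

variable {H : Type*} [NormedAddCommGroup H] [InnerProductSpace ℂ H] [CompleteSpace H]
  {ι : Type*} {m : ℕ} {N N₁ N₂ : H →L[ℂ] H}

lemma norm_sum_smul_cfc_le (s : Finset ι) {a : ι → ℂ → ℂ} (ha : ∀ i, Continuous (a i)) {A : ℝ}
    (hA0 : 0 ≤ A) (hA : ∀ z ∈ spectrum ℂ N, ∑ i ∈ s, ‖a i z‖ ≤ A)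
    {c : ι → ℂ} (hc : ∀ i, ‖c i‖ ≤ 1) : ‖∑ i ∈ s, c i • cfc (a i) N‖ ≤ A := by
  have h1 : ∑ i ∈ s, c i • cfc (a i) N = cfc (fun z => ∑ i ∈ s, c i * a i z) N := by
    have h2 : (fun z => ∑ i ∈ s, c i * a i z) = ∑ i ∈ s, fun z => c i * a i z := by
      ext z
      simp
    rw [h2, cfc_sum s (f := fun i z => c i * a i z) (a := N)
      (hf := fun i _ => (continuous_const.mul (ha i)).continuousOn)]
    refine Finset.sum_congr rfl fun i _ => ?_
    rw [cfc_const_mul (c i) (a i) N (ha i).continuousOn]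
  rw [h1]
  refine norm_cfc_le hA0 fun z hz => (norm_sum_le_of_le _ fun i _ => ?_).trans (hA z hz)
  rw [norm_mul]
  exact mul_le_of_le_one_left (norm_nonneg _) (hc i)

/-- The two-sided multiplier `T ↦ ∑ p_i(N₁) T q_i(N₂)`. -/
noncomputable def twoSided (s : Finset ι) (p q : ι → ℂ → ℂ) (N₁ N₂ T : H →L[ℂ] H) : H →L[ℂ] H :=
  ∑ i ∈ s, cfc (p i) N₁ * T * cfc (q i) N₂

lemma twoSided_sub (s : Finset ι) (p q : ι → ℂ → ℂ) (N₁ N₂ T S : H →L[ℂ] H) :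
    twoSided s p q N₁ N₂ (T - S) = twoSided s p q N₁ N₂ T - twoSided s p q N₁ N₂ S := by
  simp only [twoSided, mul_sub, sub_mul, Finset.sum_sub_distrib]

lemma twoSided_mul_mul (s : Finset ι) (p q : ι → ℂ → ℂ) (f g : ℂ → ℂ) (T : H →L[ℂ] H) :
    twoSided s p q N₁ N₂ (cfc f N₁ * T * cfc g N₂) =
      cfc f N₁ * twoSided s p q N₁ N₂ T * cfc g N₂ := by
  simp only [twoSided, Finset.mul_sum, Finset.sum_mul]
  refine Finset.sum_congr rfl fun i _ => ?_
  have h1 := (cfc_commute_cfc (p i) f N₁).eq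
  have h2 := (cfc_commute_cfc g (q i) N₂).eq
  calc _ = (cfc (p i) N₁ * cfc f N₁) * T * (cfc g N₂ * cfc (q i) N₂) := by noncomm_ring
    _ = _ := by rw [h1, h2]; noncomm_ring

lemma twoSided_mul_left (s : Finset ι) (p q : ι → ℂ → ℂ) (f : ℂ → ℂ) (T : H →L[ℂ] H)
    (hN₂ : IsStarNormal N₂) :
    twoSided s p q N₁ N₂ (cfc f N₁ * T) = cfc f N₁ * twoSided s p q N₁ N₂ T := by
  simpa [cfc_const_one ℂ N₂] using twoSided_mul_mul (N₁ := N₁) (N₂ := N₂) s p q f (fun _ => 1) T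

lemma twoSided_mul_right (s : Finset ι) (p q : ι → ℂ → ℂ) (f : ℂ → ℂ) (T : H →L[ℂ] H)
    (hN₁ : IsStarNormal N₁) :
    twoSided s p q N₁ N₂ (T * cfc f N₂) = twoSided s p q N₁ N₂ T * cfc f N₂ := by
  simpa [cfc_const_one ℂ N₁] using twoSided_mul_mul (N₁ := N₁) (N₂ := N₂) s p q (fun _ => 1) f T

lemma twoSided_comm {κ : Type*} (s : Finset ι) (p q : ι → ℂ → ℂ) (s' : Finset κ)
    (p' q' : κ → ℂ → ℂ) (T : H →L[ℂ] H) :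
    twoSided s p q N₁ N₂ (twoSided s' p' q' N₁ N₂ T) =
      twoSided s' p' q' N₁ N₂ (twoSided s p q N₁ N₂ T) := by
  have h : ∀ i, twoSided s p q N₁ N₂ (cfc (p' i) N₁ * T * cfc (q' i) N₂) =
      cfc (p' i) N₁ * twoSided s p q N₁ N₂ T * cfc (q' i) N₂ := fun i => twoSided_mul_mul ..
  rw [twoSided.eq_def s' p' q' N₁ N₂ (twoSided s p q N₁ N₂ T)]
  simp_rw [← h]
  simp only [twoSided, Finset.mul_sum, Finset.sum_mul]
  exact Finset.sum_comm

lemma KyFanLE.twoSided_commutator {s : Finset ι} {p q : ι → ℂ → ℂ} {f : ℂ → ℂ} {c : ι → ℂ}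
    {P Q ω κ : ℝ} {E : H →L[ℂ] H} (hE : KyFanLE m E κ) (hκ : 0 ≤ κ)
    (hN₁ : IsStarNormal N₁) (hN₂ : IsStarNormal N₂) (hp : ∀ i, Continuous (p i))
    (hq : ∀ i, Continuous (q i)) (hf : Continuous f) (hP : 0 ≤ P) (hQ : 0 ≤ Q) (hω : 0 ≤ ω)
    (hpP : ∀ z ∈ spectrum ℂ N₁, ∑ i ∈ s, ‖p i z‖ ≤ P)
    (hqQ : ∀ z ∈ spectrum ℂ N₂, ∑ i ∈ s, ‖q i z‖ ≤ Q)
    (hpf : ∀ i z, ‖p i z * (f z - c i)‖ ≤ ω * ‖p i z‖)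
    (hqf : ∀ i z, ‖q i z * (f z - c i)‖ ≤ ω * ‖q i z‖) :
    KyFanLE m (twoSided s p q N₁ N₂ (cfc f N₁ * E - E * cfc f N₂)) (2 * (ω * P * Q * κ)) := by
  have hmul : ∀ (g : ℂ → ℂ), Continuous g → ∀ (d : ℂ) (N : H →L[ℂ] H), IsStarNormal N →
      cfc (fun z => g z * (f z - d)) N = cfc g N * cfc f N - d • cfc g N := by
    intro g hg d N hN
    rw [cfc_mul g (fun z => f z - d) N hg.continuousOn (hf.sub continuous_const).continuousOn,
      cfc_sub f (fun _ => d) N hf.continuousOn continuousOn_const, cfc_const d N, mul_sub,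
      ← Algebra.commutes, Algebra.smul_def]
  have hdecomp : twoSided s p q N₁ N₂ (cfc f N₁ * E - E * cfc f N₂) =
      ∑ i ∈ s, cfc (fun z => p i z * (f z - c i)) N₁ * E * cfc (q i) N₂ -
        ∑ i ∈ s, cfc (p i) N₁ * E * cfc (fun z => q i z * (f z - c i)) N₂ := by
    rw [twoSided, ← Finset.sum_sub_distrib]
    refine Finset.sum_congr rfl fun i _ => ?_
    rw [hmul _ (hp i) _ _ hN₁, hmul _ (hq i) _ _ hN₂, ((cfc_commute_cfc (q i) f N₂).eq)]
    simp only [mul_sub, sub_mul, smul_mul_assoc, mul_smul_comm, mul_assoc]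
    abel
  have hsum : ∀ (a b : ι → ℂ → ℂ) (A B : ℝ), (∀ i, Continuous (a i)) → (∀ i, Continuous (b i)) →
      0 ≤ A → 0 ≤ B → (∀ z ∈ spectrum ℂ N₁, ∑ i ∈ s, ‖a i z‖ ≤ A) →
      (∀ z ∈ spectrum ℂ N₂, ∑ i ∈ s, ‖b i z‖ ≤ B) →
      KyFanLE m (∑ i ∈ s, cfc (a i) N₁ * E * cfc (b i) N₂) (A * B * κ) := by
    intro a b A B ha hb hA hB haA hbB
    have := KyFanLE.sum_mul_mul_of_signs (m := m) (C := A * B * κ) s (fun i => cfc (a i) N₁)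
      (fun i => cfc (b i) N₂) E 0 0 fun ε hε => by
        rw [zero_add, zero_add]
        exact hE.mul _ _ (norm_sum_smul_cfc_le s ha hA haA hε)
          (norm_sum_smul_cfc_le s hb hB hbB hε) hκ
    simpa using this
  rw [hdecomp]
  have h1 := hsum (fun i z => p i z * (f z - c i)) q (ω * P) Q
    (fun i => (hp i).mul (hf.sub continuous_const)) hq (by positivity) hQ
    (fun z hz => (Finset.sum_le_sum fun i _ => hpf i z).trans (by
      rw [← Finset.mul_sum]
      exact mul_le_mul_of_nonneg_left (hpP z hz) hω)) hqQ
  have h2 := hsum p (fun i z => q i z * (f z - c i)) P (ω * Q) hp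
    (fun i => (hq i).mul (hf.sub continuous_const)) hP (by positivity) hpP
    (fun z hz => (Finset.sum_le_sum fun i _ => hqf i z).trans (by
      rw [← Finset.mul_sum]
      exact mul_le_mul_of_nonneg_left (hqQ z hz) hω))
  exact (h1.sub h2).mono (le_of_eq (by ring))

end Localization

section Exponential

variable {H : Type*} [NormedAddCommGroup H] [InnerProductSpace ℂ H] [CompleteSpace H]
  {m : ℕ} {N₁ N₂ : H →L[ℂ] H} {κ : ℝ}

open ComplexConjugate

/-- The character `z ↦ exp (i Re (conj w * z))` of the plane. -/
noncomputable def planeChar (w z : ℂ) : ℂ := Complex.exp (((conj w * z).re : ℂ) * Complex.I)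

@[fun_prop]
lemma continuous_planeChar (w : ℂ) : Continuous (planeChar w) := by
  unfold planeChar
  fun_prop

lemma norm_planeChar (w z : ℂ) : ‖planeChar w z‖ = 1 := Complex.norm_exp_ofReal_mul_I _

lemma planeChar_div_pow (w z : ℂ) {n : ℕ} (hn : n ≠ 0) :
    planeChar (w / n) z ^ n = planeChar w z := by
  have hn' : (n : ℂ) ≠ 0 := by exact_mod_cast hn
  rw [planeChar, ← Complex.exp_nat_mul, planeChar]
  congr 1
  have : (conj (w / n) * z).re = (conj w * z).re / n := by
    rw [map_div₀, Complex.conj_natCast, div_mul_eq_mul_div, Complex.div_natCast_re]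
  rw [this]
  push_cast
  field_simp

lemma exists_norm_le_of_mem_spectrum (N : H →L[ℂ] H) :
    ∃ r : ℝ, 0 ≤ r ∧ ∀ z ∈ spectrum ℂ N, ‖z‖ ≤ r := by
  obtain ⟨r, hr⟩ := (spectrum.isCompact (𝕜 := ℂ) N).isBounded.exists_norm_le
  exact ⟨max r 0, le_max_right _ _, fun z hz => (hr z hz).trans (le_max_left _ _)⟩

lemma KyFanLE.pow_sub_pow {U V : H →L[ℂ] H} {c : ℝ} (h : KyFanLE m (U - V) c) (hc : 0 ≤ c)
    (hV : ‖V‖ ≤ 1) (n : ℕ) (hUn : ∀ k : ℕ, ‖U ^ k‖ ≤ 1) :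
    KyFanLE m (U ^ n - V ^ n) (n * c) := by
  have h1 : ‖(1 : H →L[ℂ] H)‖ ≤ 1 := ContinuousLinearMap.norm_id_le
  induction n with
  | zero => simpa using KyFanLE.zero
  | succ n ih =>
    have h2 := (h.mul (U ^ n) 1 (hUn n) h1 hc).add (ih.mul 1 V h1 hV (by positivity))
    convert h2 using 1
    · rw [pow_succ, pow_succ]
      noncomm_ring
    · push_cast
      ring

lemma cfc_re_conj_mul (w : ℂ) {N : H →L[ℂ] H} (hN : IsStarNormal N) :
    cfc (fun z => ((conj w * z).re : ℂ)) N = (1 / 2 : ℂ) • (conj w • N + w • star N) := by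
  have h : (fun z : ℂ => ((conj w * z).re : ℂ)) =
      fun z => (1 / 2 : ℂ) * (conj w * z + w * star z) := by
    ext z
    rw [Complex.re_eq_add_conj]
    simp
    ring
  rw [h, cfc_const_mul _ _ N (by fun_prop), cfc_add _ _ _ (by fun_prop) (by fun_prop),
    cfc_const_mul _ _ N (by fun_prop), cfc_const_mul _ _ N (by fun_prop), cfc_id' ℂ N,
    cfc_star_id (a := N)]

lemma KyFanLE.cfc_re_conj_mul_sub (h : KyFanLE m (N₁ - N₂) κ) (hN₁ : IsStarNormal N₁)
    (hN₂ : IsStarNormal N₂) (w : ℂ) :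
    KyFanLE m (cfc (fun z => ((conj w * z).re : ℂ)) N₁ - cfc (fun z => ((conj w * z).re : ℂ)) N₂)
      (‖w‖ * κ) := by
  rw [cfc_re_conj_mul w hN₁, cfc_re_conj_mul w hN₂]
  have h1 := ((h.smul (conj w)).add (h.star_right.smul w)).smul (1 / 2)
  convert h1 using 1
  · rw [star_sub]
    module
  · simp
    ring

lemma norm_cfc_planeChar_sub_le (w : ℂ) {N : H →L[ℂ] H} (hN : IsStarNormal N) {r : ℝ}
    (hr : ∀ z ∈ spectrum ℂ N, ‖z‖ ≤ r) (hwr : ‖w‖ * r ≤ 1) :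
    ‖cfc (planeChar w) N - (1 + Complex.I • cfc (fun z => ((conj w * z).re : ℂ)) N)‖ ≤
      (‖w‖ * r) ^ 2 := by
  have h : cfc (planeChar w) N - (1 + Complex.I • cfc (fun z => ((conj w * z).re : ℂ)) N) =
      cfc (fun z => planeChar w z - (1 + Complex.I * ((conj w * z).re : ℂ))) N := by
    rw [cfc_sub _ _ N (by fun_prop) (by fun_prop), cfc_const_add _ _ N (by fun_prop),
      cfc_const_mul _ _ N (by fun_prop), map_one]
  rw [h]
  refine norm_cfc_le (by positivity) fun z hz => ?_
  have h1 : ‖(((conj w * z).re : ℂ) * Complex.I)‖ ≤ ‖w‖ * r := by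
    rw [norm_mul, Complex.norm_I, mul_one, Complex.norm_real]
    refine (Complex.abs_re_le_norm _).trans ?_
    rw [norm_mul, RCLike.norm_conj]
    gcongr
    exact hr z hz
  have h2 := Complex.norm_exp_sub_one_sub_id_le (h1.trans hwr)
  calc _ = ‖Complex.exp (((conj w * z).re : ℂ) * Complex.I) - 1 -
        (((conj w * z).re : ℂ) * Complex.I)‖ := by
        rw [planeChar]
        congr 1
        ring
    _ ≤ _ := h2.trans (by gcongr)

/-- Characters are operator Lipschitz in every Ky Fan norm. -/
lemma KyFanLE.cfc_planeChar_sub (h : KyFanLE m (N₁ - N₂) κ) (hκ : 0 ≤ κ) (hN₁ : IsStarNormal N₁)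
    (hN₂ : IsStarNormal N₂) (w : ℂ) :
    KyFanLE m (cfc (planeChar w) N₁ - cfc (planeChar w) N₂) (‖w‖ * κ) := by
  obtain ⟨r₁, hr₁0, hr₁⟩ := exists_norm_le_of_mem_spectrum N₁
  obtain ⟨r₂, hr₂0, hr₂⟩ := exists_norm_le_of_mem_spectrum N₂
  set r := r₁ + r₂ with hr
  set B := ‖w‖ * r with hB
  have hlim : Filter.Tendsto (fun n : ℕ => ‖w‖ * κ + 2 * m * B ^ 2 / n) Filter.atTop
      (nhds (‖w‖ * κ)) := by
    simpa using (tendsto_const_div_atTop_nhds_zero_nat (2 * m * B ^ 2)).const_add (‖w‖ * κ)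
  refine KyFanLE.of_tendsto tendsto_const_nhds hlim ?_
  filter_upwards [Filter.eventually_ge_atTop (max 1 ⌈B⌉₊)] with n hn
  have hn1 : 1 ≤ n := (le_max_left _ _).trans hn
  have hn0 : (0 : ℝ) < n := by exact_mod_cast hn1
  have hnB : B ≤ n := (Nat.le_ceil B).trans (by exact_mod_cast (le_max_right _ _).trans hn)
  have hwn : ‖w / n‖ = ‖w‖ / n := by simp
  have hwr : ‖w / n‖ * r ≤ 1 := by
    rw [hwn, div_mul_eq_mul_div, div_le_one hn0]
    exact hnB
  have hpow : ∀ N : H →L[ℂ] H, IsStarNormal N → ∀ k : ℕ,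
      cfc (planeChar (w / n)) N ^ k = cfc (fun z => planeChar (w / n) z ^ k) N :=
    fun N hN k => (cfc_pow _ k N (by fun_prop)).symm
  have hnorm : ∀ N : H →L[ℂ] H, IsStarNormal N → ∀ k : ℕ, ‖cfc (planeChar (w / n)) N ^ k‖ ≤ 1 := by
    intro N hN k
    rw [hpow N hN]
    exact norm_cfc_le zero_le_one fun z _ => by simp [norm_planeChar]
  have hnorm1 : ∀ N : H →L[ℂ] H, IsStarNormal N → ‖cfc (planeChar (w / n)) N‖ ≤ 1 :=
    fun N hN => by simpa using hnorm N hN 1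
  have hfull : ∀ N : H →L[ℂ] H, IsStarNormal N →
      cfc (planeChar (w / n)) N ^ n = cfc (planeChar w) N := by
    intro N hN
    rw [hpow N hN]
    simp_rw [planeChar_div_pow w _ (by omega : n ≠ 0)]
  have e₁ := norm_cfc_planeChar_sub_le (w / n) hN₁ (r := r) (fun z hz => (hr₁ z hz).trans
    (by linarith)) hwr
  have e₂ := norm_cfc_planeChar_sub_le (w / n) hN₂ (r := r) (fun z hz => (hr₂ z hz).trans
    (by linarith)) hwr
  have hstep : KyFanLE m (cfc (planeChar (w / n)) N₁ - cfc (planeChar (w / n)) N₂)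
      (‖w / n‖ * κ + (m * (‖w / n‖ * r) ^ 2 + m * (‖w / n‖ * r) ^ 2)) := by
    have h1 := ((h.cfc_re_conj_mul_sub hN₁ hN₂ (w / n)).smul Complex.I).add
      ((KyFanLE.of_norm_le (m := m) e₁).sub (KyFanLE.of_norm_le (m := m) e₂))
    convert h1 using 1
    · module
    · simp
  have h2 := hstep.pow_sub_pow (by positivity) (hnorm1 N₂ hN₂) n (hnorm N₁ hN₁)
  rw [hfull N₁ hN₁, hfull N₂ hN₂] at h2
  refine h2.mono (le_of_eq ?_)
  rw [hwn, hB]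
  field_simp
  ring

end Exponential

section FourierRepresentation

open MeasureTheory FourierTransform SchwartzMap
open ComplexConjugate

lemma planeChar_div_sub (w z c : ℂ) (δ : ℝ) :
    planeChar w (z / δ - c) = planeChar w (-c) * planeChar (w / δ) z := by
  rw [planeChar, planeChar, planeChar, ← Complex.exp_add, ← add_mul]
  congr 2
  rw [← Complex.ofReal_add]
  congr 1
  rw [map_div₀, Complex.conj_ofReal, sub_eq_add_neg, mul_add, Complex.add_re, add_comm,
    mul_div_assoc', div_mul_eq_mul_div]

lemma continuous_uncurry_planeChar {X : Type*} [TopologicalSpace X] {a b : X → ℂ}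
    (ha : Continuous a) (hb : Continuous b) : Continuous fun x => planeChar (a x) (b x) := by
  unfold planeChar
  fun_prop

lemma SchwartzMap.eq_integral_planeChar (q : 𝓢(ℂ, ℂ)) (z : ℂ) :
    q z = ∫ ζ, (𝓕 q) ζ * planeChar (2 * Real.pi * ζ) z := by
  have h1 : (𝓕⁻ (𝓕 q)) z = q z := by rw [FourierTransform.fourierInv_fourier_eq]
  rw [← h1, SchwartzMap.fourierInv_coe, Real.fourierInv_eq']
  refine integral_congr_ae (Filter.Eventually.of_forall fun ζ => ?_)
  simp only [smul_eq_mul, planeChar, Complex.inner]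
  rw [mul_comm]
  congr 3
  simp [mul_assoc]
  ring

variable {H : Type*} [NormedAddCommGroup H] [InnerProductSpace ℂ H]

lemma KyFanLE.integral {X : Type*} [MeasurableSpace X] {μ : Measure X} {m : ℕ}
    [CompleteSpace H] {T : X → H →L[ℂ] H} {c : X → ℝ} (hT : Integrable T μ) (hc : Integrable c μ)
    (h : ∀ x, KyFanLE m (T x) (c x)) : KyFanLE m (∫ x, T x ∂μ) (∫ x, c x ∂μ) := fun X Y => by
  rw [← ContinuousLinearMap.integral_comp_comm _ hT, mul_assoc, ← integral_mul_const]
  refine norm_integral_le_of_norm_le (hc.mul_const _) (Filter.Eventually.of_forall fun x => ?_)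
  rw [← mul_assoc]
  exact h x X Y

variable [CompleteSpace H] {ι : Type*} {m : ℕ} {N N₁ N₂ : H →L[ℂ] H}

lemma integrable_smul_cfc_planeChar {g a b : ℂ → ℂ} (hg : Continuous g)
    (hgi : Integrable g) (ha : Continuous a) (hb : Continuous b) (hN : IsStarNormal N) (c : ℂ) :
    Integrable fun ζ => (g ζ * planeChar (a ζ) c) • cfc (planeChar (b ζ)) N := by
  have h := integrable_cfc (μ := volume) (fun ζ z => (g ζ * planeChar (a ζ) c) * planeChar (b ζ) z)
    (fun ζ => ‖g ζ‖) N
    (((hg.comp continuous_fst).mul (continuous_uncurry_planeChar (ha.comp continuous_fst)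
      continuous_const)).mul (continuous_uncurry_planeChar (hb.comp continuous_fst)
      continuous_snd)).continuousOn
    (Filter.Eventually.of_forall fun ζ z _ => by simp [norm_planeChar]) hgi.norm.2
  refine h.congr (Filter.Eventually.of_forall fun ζ => ?_)
  exact cfc_const_mul _ _ N (by fun_prop)

lemma cfc_eq_integral_planeChar (q : 𝓢(ℂ, ℂ)) (δ : ℝ) (c : ℂ) (hN : IsStarNormal N) :
    cfc (fun z => q (z / δ - c)) N = ∫ ζ : ℂ, ((𝓕 q) ζ * planeChar (2 * Real.pi * ζ) (-c)) •
      cfc (planeChar (2 * Real.pi * ζ / δ)) N := by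
  have h1 : (fun z => q (z / δ - c)) = fun z => ∫ ζ, ((𝓕 q) ζ *
      planeChar (2 * Real.pi * ζ) (-c)) * planeChar (2 * Real.pi * ζ / δ) z := by
    ext z
    rw [SchwartzMap.eq_integral_planeChar]
    simp_rw [planeChar_div_sub, mul_assoc]
  rw [h1]
  refine (cfc_integral (μ := volume) (fun ζ z => ((𝓕 q) ζ *
      planeChar (2 * Real.pi * ζ) (-c)) * planeChar (2 * Real.pi * ζ / δ) z) (fun ζ => ‖(𝓕 q) ζ‖) N
    ?_ ?_ (𝓕 q).integrable.norm.2).trans ?_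
  · exact (((𝓕 q).continuous.comp continuous_fst).mul (continuous_uncurry_planeChar
      (by fun_prop) continuous_const)).mul (continuous_uncurry_planeChar
      (by fun_prop) continuous_snd) |>.continuousOn
  · exact Filter.Eventually.of_forall fun ζ z _ => by simp [norm_planeChar]
  · refine integral_congr_ae (Filter.Eventually.of_forall fun ζ => ?_)
    exact cfc_const_mul _ _ N (by fun_prop)

lemma KyFanLE.sum_cfc_mul_cfc_sub (q : 𝓢(ℂ, ℂ)) {κ δ P : ℝ} (hδ : 0 < δ)
    (h : KyFanLE m (N₁ - N₂) κ) (hκ : 0 ≤ κ) (hN₁ : IsStarNormal N₁) (hN₂ : IsStarNormal N₂)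
    (s : Finset ι) {p : ι → ℂ → ℂ} (hp : ∀ i, Continuous (p i)) (hP : 0 ≤ P)
    (hpP : ∀ z ∈ spectrum ℂ N₁, ∑ i ∈ s, ‖p i z‖ ≤ P) (c : ι → ℂ) :
    KyFanLE m (∑ i ∈ s, cfc (p i) N₁ * (cfc (fun z => q (z / δ - c i)) N₁ -
        cfc (fun z => q (z / δ - c i)) N₂))
      ((∫ ζ, ‖ζ‖ * ‖(𝓕 q) ζ‖) * (2 * Real.pi * P * κ / δ)) := by
  have hint : ∀ N : H →L[ℂ] H, IsStarNormal N → ∀ i, Integrable fun ζ : ℂ =>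
      ((𝓕 q) ζ * planeChar (2 * Real.pi * ζ) (-c i)) • cfc (planeChar (2 * Real.pi * ζ / δ)) N :=
    fun N hN i => integrable_smul_cfc_planeChar (𝓕 q).continuous (𝓕 q).integrable
      (by fun_prop) (by fun_prop) hN _
  have hint' : ∀ i, Integrable fun ζ : ℂ => cfc (p i) N₁ *
      (((𝓕 q) ζ * planeChar (2 * Real.pi * ζ) (-c i)) • cfc (planeChar (2 * Real.pi * ζ / δ)) N₁ -
      ((𝓕 q) ζ * planeChar (2 * Real.pi * ζ) (-c i)) • cfc (planeChar (2 * Real.pi * ζ / δ)) N₂) :=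
    fun i => ((hint N₁ hN₁ i).sub (hint N₂ hN₂ i)).const_mul _
  have hmom : Integrable fun ζ : ℂ => ‖ζ‖ * ‖(𝓕 q) ζ‖ :=
    ((𝓕 q).integrable_pow_mul volume 1).congr (Filter.Eventually.of_forall fun ζ => by
      simp only [pow_one])
  have hrep : ∀ i, cfc (p i) N₁ * (cfc (fun z => q (z / δ - c i)) N₁ -
        cfc (fun z => q (z / δ - c i)) N₂) = ∫ ζ : ℂ, cfc (p i) N₁ *
      (((𝓕 q) ζ * planeChar (2 * Real.pi * ζ) (-c i)) • cfc (planeChar (2 * Real.pi * ζ / δ)) N₁ -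
      ((𝓕 q) ζ * planeChar (2 * Real.pi * ζ) (-c i)) • cfc (planeChar (2 * Real.pi * ζ / δ)) N₂) := by
    intro i
    rw [cfc_eq_integral_planeChar q δ (c i) hN₁, cfc_eq_integral_planeChar q δ (c i) hN₂,
      ← integral_sub (hint N₁ hN₁ i) (hint N₂ hN₂ i)]
    exact (integral_const_mul_of_integrable ((hint N₁ hN₁ i).sub (hint N₂ hN₂ i))).symm
  rw [Finset.sum_congr rfl fun i _ => hrep i, ← integral_finsetSum _ fun i _ => hint' i,
    ← integral_mul_const]
  refine KyFanLE.integral (integrable_finsetSum _ fun i _ => hint' i)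
    (hmom.mul_const _) fun ζ => ?_
  have h1 := ((h.cfc_planeChar_sub hκ hN₁ hN₂ (2 * Real.pi * ζ / δ)).mul
    (∑ i ∈ s, planeChar (2 * Real.pi * ζ) (-c i) • cfc (p i) N₁) 1
    (norm_sum_smul_cfc_le s hp hP hpP fun i => (norm_planeChar _ _).le)
    ContinuousLinearMap.norm_id_le (by positivity)).smul ((𝓕 q) ζ)
  convert h1 using 1
  · rw [mul_one, Finset.sum_mul, Finset.smul_sum]
    refine Finset.sum_congr rfl fun i _ => ?_
    rw [← smul_sub, mul_smul_comm, smul_mul_assoc, smul_smul]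
  · simp only [norm_div, norm_mul, Complex.norm_real, Real.norm_eq_abs, abs_of_pos hδ,
      abs_of_pos Real.pi_pos, Complex.norm_ofNat]
    field_simp

end FourierRepresentation

section Lattice

open SchwartzMap FourierTransform

/-- The tent function on the line. -/
noncomputable def tent (t : ℝ) : ℝ := max 0 (1 - |t|)

lemma tent_nonneg (t : ℝ) : 0 ≤ tent t := le_max_left _ _

@[fun_prop]
lemma continuous_tent : Continuous tent := by
  unfold tent
  fun_prop

lemma tent_eq_zero {t : ℝ} (ht : 1 ≤ |t|) : tent t = 0 := max_eq_left (by linarith)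

lemma sum_tent_sub {R : ℤ} {x : ℝ} (hx : |x| < R) :
    ∑ n ∈ Finset.Icc (-R) R, tent (x - n) = 1 := by
  obtain ⟨h1, h2⟩ := abs_lt.1 hx
  have h3 := Int.floor_le x
  have h4 := Int.lt_floor_add_one x
  have hsub : ({⌊x⌋, ⌊x⌋ + 1} : Finset ℤ) ⊆ Finset.Icc (-R) R := by
    have h5 : -R ≤ ⌊x⌋ := Int.le_floor.2 (by push_cast; linarith)
    have h6 : ⌊x⌋ < R := Int.floor_lt.2 h2
    intro n hn
    simp only [Finset.mem_insert, Finset.mem_singleton] at hn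
    rw [Finset.mem_Icc]
    omega
  rw [← Finset.sum_subset hsub, Finset.sum_pair (by omega)]
  · have h5 : |x - ⌊x⌋| = x - ⌊x⌋ := abs_of_nonneg (by linarith)
    have h6 : |x - (⌊x⌋ + 1 : ℤ)| = ⌊x⌋ + 1 - x := by
      push_cast
      rw [abs_of_nonpos (by linarith)]
      ring
    rw [tent, tent, h5, h6, max_eq_right (by linarith), max_eq_right (by linarith)]
    ring
  · intro n _ hn
    simp only [Finset.mem_insert, Finset.mem_singleton, not_or] at hn
    apply tent_eq_zero
    rcases lt_or_gt_of_ne hn.1 with h | h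
    · have h5 : (n : ℝ) + 1 ≤ ⌊x⌋ := by exact_mod_cast h
      exact (by linarith : 1 ≤ x - n).trans (le_abs_self _)
    · have h5 : (⌊x⌋ : ℝ) + 1 + 1 ≤ n := by
        have : ⌊x⌋ + 1 + 1 ≤ n := by omega
        exact_mod_cast this
      exact (by linarith : 1 ≤ -(x - n)).trans (neg_le_abs _)

/-- The Gaussian integer with coordinates `n`. -/
noncomputable def latticePoint (n : ℤ × ℤ) : ℂ := ⟨n.1, n.2⟩

/-- The tensor-product partition of unity of the plane at scale `δ`. -/
noncomputable def latticeTent (δ : ℝ) (n : ℤ × ℤ) (z : ℂ) : ℂ :=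
  (tent (z.re / δ - n.1) * tent (z.im / δ - n.2) : ℝ)

lemma continuous_latticeTent (δ : ℝ) (n : ℤ × ℤ) : Continuous (latticeTent δ n) := by
  unfold latticeTent
  fun_prop

lemma norm_latticeTent (δ : ℝ) (n : ℤ × ℤ) (z : ℂ) :
    ‖latticeTent δ n z‖ = tent (z.re / δ - n.1) * tent (z.im / δ - n.2) := by
  rw [latticeTent, Complex.norm_real, Real.norm_of_nonneg
    (mul_nonneg (tent_nonneg _) (tent_nonneg _))]

lemma re_div_sub_latticePoint (δ : ℝ) (n : ℤ × ℤ) (z : ℂ) :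
    (z / δ - latticePoint n).re = z.re / δ - n.1 := by
  simp [latticePoint, Complex.div_ofReal_re]

lemma im_div_sub_latticePoint (δ : ℝ) (n : ℤ × ℤ) (z : ℂ) :
    (z / δ - latticePoint n).im = z.im / δ - n.2 := by
  simp [latticePoint, Complex.div_ofReal_im]

lemma norm_sub_latticePoint_le {δ : ℝ} {n : ℤ × ℤ} {z : ℂ} (h : latticeTent δ n z ≠ 0) :
    ‖z / δ - latticePoint n‖ ≤ 2 := by
  have h1 : |z.re / δ - n.1| < 1 := by
    by_contra! h1
    exact h (by rw [latticeTent, tent_eq_zero h1, zero_mul, Complex.ofReal_zero])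
  have h2 : |z.im / δ - n.2| < 1 := by
    by_contra! h2
    exact h (by rw [latticeTent, tent_eq_zero h2, mul_zero, Complex.ofReal_zero])
  refine (Complex.norm_le_abs_re_add_abs_im _).trans ?_
  rw [re_div_sub_latticePoint, im_div_sub_latticePoint]
  linarith

/-- The lattice points in the square of side `2R`. -/
noncomputable def latticeBox (R : ℤ) : Finset (ℤ × ℤ) := Finset.Icc (-R) R ×ˢ Finset.Icc (-R) R

lemma sum_norm_latticeTent {R : ℤ} {δ : ℝ} {z : ℂ} (h : ‖z / δ‖ < R) :
    ∑ n ∈ latticeBox R, ‖latticeTent δ n z‖ = 1 := by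
  have h1 := (Complex.abs_re_le_norm _).trans_lt h
  have h2 := (Complex.abs_im_le_norm _).trans_lt h
  rw [Complex.div_ofReal_re] at h1
  rw [Complex.div_ofReal_im] at h2
  simp_rw [norm_latticeTent]
  rw [latticeBox, Finset.sum_product, ← Finset.sum_mul_sum _ _ (fun n : ℤ => tent (z.re / δ - n))
    (fun n : ℤ => tent (z.im / δ - n)), sum_tent_sub h1, sum_tent_sub h2, one_mul]

lemma sum_latticeTent {R : ℤ} {δ : ℝ} {z : ℂ} (h : ‖z / δ‖ < R) :
    ∑ n ∈ latticeBox R, latticeTent δ n z = 1 := by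
  have h1 := congrArg (fun x : ℝ => (x : ℂ)) (sum_norm_latticeTent h)
  simp_rw [norm_latticeTent] at h1
  simp_rw [latticeTent]
  exact_mod_cast h1

lemma exists_schwartzMap_bump : ∃ q : 𝓢(ℂ, ℂ), (∀ z, ‖q z‖ ≤ 1) ∧ (∀ z, ‖z‖ ≤ 2 → q z = 1) ∧
    ∀ z, 3 ≤ ‖z‖ → q z = 0 := by
  let b : ContDiffBump (0 : ℂ) := ⟨2, 3, by norm_num, by norm_num⟩
  have hb : HasCompactSupport fun z => (b z : ℂ) := b.hasCompactSupport.comp_left Complex.ofReal_zero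
  have hs : ContDiff ℝ (⊤ : ℕ∞) fun z => (b z : ℂ) := Complex.ofRealCLM.contDiff.comp b.contDiff
  refine ⟨hb.toSchwartzMap hs, fun z => ?_, fun z hz => ?_, fun z hz => ?_⟩
  · change ‖(b z : ℂ)‖ ≤ 1
    rw [Complex.norm_real, Real.norm_of_nonneg b.nonneg]
    exact b.le_one
  · change (b z : ℂ) = 1
    rw [b.one_of_mem_closedBall (by simpa [b] using hz), Complex.ofReal_one]
  · change (b z : ℂ) = 0
    rw [b.zero_of_le_dist (by simpa [b] using hz), Complex.ofReal_zero]

/-- The translates of `q` to the lattice at scale `δ`. -/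
noncomputable def latticeTranslate (q : 𝓢(ℂ, ℂ)) (δ : ℝ) (n : ℤ × ℤ) (z : ℂ) : ℂ :=
  q (z / δ - latticePoint n)

lemma continuous_latticeTranslate (q : 𝓢(ℂ, ℂ)) (δ : ℝ) (n : ℤ × ℤ) :
    Continuous (latticeTranslate q δ n) := by
  unfold latticeTranslate
  fun_prop

lemma latticeTent_mul_latticeTranslate {q : 𝓢(ℂ, ℂ)} (hq : ∀ z, ‖z‖ ≤ 2 → q z = 1) (δ : ℝ)
    (n : ℤ × ℤ) (z : ℂ) : latticeTent δ n z * latticeTranslate q δ n z = latticeTent δ n z := by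
  rcases eq_or_ne (latticeTent δ n z) 0 with h | h
  · rw [h, zero_mul]
  · rw [latticeTranslate, hq _ (norm_sub_latticePoint_le h), mul_one]

lemma mem_Icc_floor_of_abs_sub_lt {x : ℝ} {n : ℤ} (h : |x - n| < 3) :
    n ∈ Finset.Icc (⌊x⌋ - 2) (⌊x⌋ + 3) := by
  obtain ⟨h1, h2⟩ := abs_lt.1 h
  have h3 := Int.floor_le x
  have h4 := Int.lt_floor_add_one x
  have h5 : ⌊x⌋ - 3 < n := by
    have : (⌊x⌋ : ℝ) - 3 < n := by linarith
    exact_mod_cast this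
  have h6 : n < ⌊x⌋ + 4 := by
    have : (n : ℝ) < ⌊x⌋ + 4 := by linarith
    exact_mod_cast this
  rw [Finset.mem_Icc]
  omega

lemma sum_norm_latticeTranslate_le {q : 𝓢(ℂ, ℂ)} (hq1 : ∀ z, ‖q z‖ ≤ 1)
    (hq3 : ∀ z, 3 ≤ ‖z‖ → q z = 0) (δ : ℝ) (s : Finset (ℤ × ℤ)) (z : ℂ) :
    ∑ n ∈ s, ‖latticeTranslate q δ n z‖ ≤ 36 := by
  set t : Finset (ℤ × ℤ) := Finset.Icc (⌊z.re / δ⌋ - 2) (⌊z.re / δ⌋ + 3) ×ˢ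
    Finset.Icc (⌊z.im / δ⌋ - 2) (⌊z.im / δ⌋ + 3) with ht
  have hcard : t.card = 36 := by
    rw [ht, Finset.card_product, Int.card_Icc, Int.card_Icc]
    have h : ∀ k : ℤ, (k + 3 + 1 - (k - 2)).toNat = 6 := fun k => by omega
    rw [h, h]
  have hzero : ∀ n, n ∉ t → ‖latticeTranslate q δ n z‖ = 0 := by
    intro n hn
    rw [latticeTranslate, hq3, norm_zero]
    by_contra! h
    refine hn (Finset.mem_product.2 ⟨mem_Icc_floor_of_abs_sub_lt ?_,
      mem_Icc_floor_of_abs_sub_lt ?_⟩)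
    · rw [← re_div_sub_latticePoint]
      exact (Complex.abs_re_le_norm _).trans_lt h
    · rw [← im_div_sub_latticePoint]
      exact (Complex.abs_im_le_norm _).trans_lt h
  classical
  calc ∑ n ∈ s, ‖latticeTranslate q δ n z‖ = ∑ n ∈ s with n ∈ t, ‖latticeTranslate q δ n z‖ :=
        (Finset.sum_filter_of_ne fun n _ h => by_contra fun hn => h (hzero n hn)).symm
    _ ≤ ∑ n ∈ t, ‖latticeTranslate q δ n z‖ := Finset.sum_le_sum_of_subset_of_nonneg
        (fun n hn => (Finset.mem_filter.1 hn).2) fun _ _ _ => norm_nonneg _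
    _ ≤ t.card • (1 : ℝ) := Finset.sum_le_card_nsmul _ _ _ fun n _ => hq1 _
    _ = 36 := by rw [hcard]; norm_num

lemma norm_mul_sub_le_of_holder {f g : ℂ → ℂ} {M α δ : ℝ} (hM : 0 ≤ M) (hα : 0 ≤ α) (hδ : 0 < δ)
    (hf : ∀ z₁ z₂ : ℂ, ‖f z₁ - f z₂‖ ≤ M * ‖z₁ - z₂‖ ^ α) {c z : ℂ}
    (hg : g z ≠ 0 → ‖z / δ - c‖ ≤ 3) :
    ‖g z * (f z - f (δ * c))‖ ≤ M * (3 * δ) ^ α * ‖g z‖ := by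
  rcases eq_or_ne (g z) 0 with h | h
  · simp [h]
  · have hδ' : (δ : ℂ) ≠ 0 := by exact_mod_cast hδ.ne'
    have h1 : ‖z - δ * c‖ ≤ 3 * δ := by
      have : z - δ * c = δ * (z / δ - c) := by field_simp
      rw [this, norm_mul, Complex.norm_real, Real.norm_of_nonneg hδ.le, mul_comm]
      gcongr
      exact hg h
    rw [norm_mul, mul_comm]
    gcongr
    exact (hf _ _).trans (by gcongr)

variable {H : Type*} [NormedAddCommGroup H] [InnerProductSpace ℂ H] [CompleteSpace H]
  {m : ℕ} {N₁ N₂ : H →L[ℂ] H}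

lemma sum_cfc_latticeTent_mul {q : 𝓢(ℂ, ℂ)} (hq : ∀ z, ‖z‖ ≤ 2 → q z = 1) {δ : ℝ} {R : ℤ}
    (hN₁ : IsStarNormal N₁) (hR : ∀ z ∈ spectrum ℂ N₁, ‖z / δ‖ < R) :
    ∑ n ∈ latticeBox R, cfc (latticeTent δ n) N₁ * cfc (latticeTranslate q δ n) N₁ = 1 := by
  have h : ∀ n, cfc (latticeTent δ n) N₁ * cfc (latticeTranslate q δ n) N₁ =
      cfc (latticeTent δ n) N₁ := fun n => by
    rw [← cfc_mul _ _ N₁ (continuous_latticeTent δ n).continuousOn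
      (continuous_latticeTranslate q δ n).continuousOn]
    exact congrArg (fun g => cfc g N₁) (funext (latticeTent_mul_latticeTranslate hq δ n))
  simp_rw [h]
  rw [← cfc_sum (latticeBox R) (f := latticeTent δ) (a := N₁)
    (hf := fun n _ => (continuous_latticeTent δ n).continuousOn), ← cfc_const_one ℂ N₁]
  refine cfc_congr fun z hz => ?_
  simpa using sum_latticeTent (hR z hz)

lemma KyFanLE.one_sub_twoSided_one {q : 𝓢(ℂ, ℂ)} (hq : ∀ z, ‖z‖ ≤ 2 → q z = 1) {κ δ : ℝ}
    (hδ : 0 < δ) (h : KyFanLE m (N₁ - N₂) κ) (hκ : 0 ≤ κ) (hN₁ : IsStarNormal N₁)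
    (hN₂ : IsStarNormal N₂) {R : ℤ} (hR : ∀ z ∈ spectrum ℂ N₁, ‖z / δ‖ < R) :
    KyFanLE m (1 - twoSided (latticeBox R) (latticeTent δ) (latticeTranslate q δ) N₁ N₂ 1)
      ((∫ ζ, ‖ζ‖ * ‖(𝓕 q) ζ‖) * (2 * Real.pi * κ / δ)) := by
  have h1 := KyFanLE.sum_cfc_mul_cfc_sub q hδ h hκ hN₁ hN₂ (latticeBox R)
    (continuous_latticeTent δ) zero_le_one (fun z hz => (sum_norm_latticeTent (hR z hz)).le)
    latticePoint
  convert h1 using 1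
  · simp only [mul_sub, Finset.sum_sub_distrib, twoSided, mul_one]
    rw [← sum_cfc_latticeTent_mul hq hN₁ hR]
    rfl
  · rw [mul_one]

lemma KyFanLE.twoSided_lattice_commutator {q : 𝓢(ℂ, ℂ)} (hq1 : ∀ z, ‖q z‖ ≤ 1)
    (hq3 : ∀ z, 3 ≤ ‖z‖ → q z = 0) {f : ℂ → ℂ} {M α δ : ℝ} (hM : 0 ≤ M) (hα : 0 ≤ α)
    (hf : ∀ z₁ z₂ : ℂ, ‖f z₁ - f z₂‖ ≤ M * ‖z₁ - z₂‖ ^ α) (hfc : Continuous f) (hδ : 0 < δ)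
    {E : H →L[ℂ] H} {κ : ℝ} (hE : KyFanLE m E κ) (hκ : 0 ≤ κ) (hN₁ : IsStarNormal N₁)
    (hN₂ : IsStarNormal N₂) {R : ℤ} (hR : ∀ z ∈ spectrum ℂ N₁, ‖z / δ‖ < R) :
    KyFanLE m (twoSided (latticeBox R) (latticeTent δ) (latticeTranslate q δ) N₁ N₂
      (cfc f N₁ * E - E * cfc f N₂)) (72 * 3 ^ α * M * δ ^ α * κ) := by
  refine (hE.twoSided_commutator hκ hN₁ hN₂ (continuous_latticeTent δ)
    (continuous_latticeTranslate q δ) hfc zero_le_one (by norm_num : (0 : ℝ) ≤ 36)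
    (by positivity : 0 ≤ M * (3 * δ) ^ α) (fun z hz => (sum_norm_latticeTent (hR z hz)).le)
    (fun z _ => sum_norm_latticeTranslate_le hq1 hq3 δ _ z)
    (fun n z => norm_mul_sub_le_of_holder (c := latticePoint n) hM hα hδ hf fun h =>
      (norm_sub_latticePoint_le h).trans (by norm_num))
    (fun n z => norm_mul_sub_le_of_holder (c := latticePoint n) hM hα hδ hf fun h => ?_)).mono
      (le_of_eq ?_)
  · by_contra! h1
    exact h (hq3 _ h1.le)
  · rw [Real.mul_rpow (by norm_num) hδ.le]
    ring

end Lattice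

section HolderEstimate

open SchwartzMap FourierTransform

variable {H : Type*} [NormedAddCommGroup H] [InnerProductSpace ℂ H] [CompleteSpace H]
  {m : ℕ} {N₁ N₂ : H →L[ℂ] H}

lemma exists_int_norm_div_lt (N : H →L[ℂ] H) {δ : ℝ} (hδ : 0 < δ) :
    ∃ R : ℤ, ∀ d : ℝ, δ ≤ d → ∀ z ∈ spectrum ℂ N, ‖z / d‖ < R := by
  obtain ⟨r, hr0, hr⟩ := exists_norm_le_of_mem_spectrum N
  obtain ⟨R, hR⟩ := exists_int_gt (r / δ)
  refine ⟨R, fun d hd z hz => lt_of_le_of_lt ?_ hR⟩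
  rw [norm_div, Complex.norm_real, Real.norm_of_nonneg (hδ.le.trans hd)]
  gcongr
  exact hr z hz

lemma continuous_of_norm_sub_le_rpow {f : ℂ → ℂ} {M α : ℝ} (hα : 0 < α)
    (hf : ∀ z₁ z₂ : ℂ, ‖f z₁ - f z₂‖ ≤ M * ‖z₁ - z₂‖ ^ α) : Continuous f := by
  refine continuous_iff_continuousAt.2 fun z₀ => tendsto_iff_norm_sub_tendsto_zero.2 ?_
  have h : Continuous fun z : ℂ => M * ‖z - z₀‖ ^ α :=
    continuous_const.mul ((by fun_prop : Continuous fun z : ℂ => ‖z - z₀‖).rpow_const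
      fun _ => Or.inr hα.le)
  refine squeeze_zero (fun _ => norm_nonneg _) (fun z => hf z z₀) ?_
  simpa [Real.zero_rpow hα.ne'] using h.tendsto z₀

lemma sum_geometric_le {r : ℝ} (h0 : 0 ≤ r) (h1 : r < 1) (n : ℕ) :
    ∑ k ∈ Finset.range n, r ^ k ≤ (1 - r)⁻¹ := by
  rw [← tsum_geometric_of_lt_one h0 h1]
  exact (summable_geometric_of_lt_one h0 h1).sum_le_tsum _ fun _ _ => by positivity

lemma sub_twoSided_sub {ι : Type*} (s : Finset ι) (p q : ι → ℂ → ℂ) (f : ℂ → ℂ)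
    (hN₁ : IsStarNormal N₁) (hN₂ : IsStarNormal N₂) :
    cfc f N₁ - cfc f N₂ - twoSided s p q N₁ N₂ (cfc f N₁ - cfc f N₂) =
      cfc f N₁ * (1 - twoSided s p q N₁ N₂ 1) - (1 - twoSided s p q N₁ N₂ 1) * cfc f N₂ := by
  have h1 := twoSided_mul_left (N₁ := N₁) s p q f 1 hN₂
  have h2 := twoSided_mul_right (N₂ := N₂) s p q f 1 hN₁
  rw [mul_one] at h1
  rw [one_mul] at h2
  rw [twoSided_sub, h1, h2]
  noncomm_ring

lemma twoSided_sub_twoSided {ι κ : Type*} (s : Finset ι) (p q : ι → ℂ → ℂ) (s' : Finset κ)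
    (p' q' : κ → ℂ → ℂ) (f : ℂ → ℂ) (hN₁ : IsStarNormal N₁) (hN₂ : IsStarNormal N₂) :
    twoSided s' p' q' N₁ N₂ (cfc f N₁ - cfc f N₂) - twoSided s p q N₁ N₂ (cfc f N₁ - cfc f N₂) =
      twoSided s' p' q' N₁ N₂ (cfc f N₁ * (1 - twoSided s p q N₁ N₂ 1) -
        (1 - twoSided s p q N₁ N₂ 1) * cfc f N₂) -
      twoSided s p q N₁ N₂ (cfc f N₁ * (1 - twoSided s' p' q' N₁ N₂ 1) -
        (1 - twoSided s' p' q' N₁ N₂ 1) * cfc f N₂) := by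
  rw [← sub_twoSided_sub s p q f hN₁ hN₂, ← sub_twoSided_sub s' p' q' f hN₁ hN₂]
  generalize cfc f N₁ - cfc f N₂ = G
  rw [twoSided_sub, twoSided_sub, twoSided_comm s p q s' p' q']
  abel

/-- The Ky Fan norms of `f(N₁) - f(N₂)` at the scale `δ`. -/
lemma KyFanLE.cfc_sub_cfc_of_holder {q : 𝓢(ℂ, ℂ)} (hq1 : ∀ z, ‖q z‖ ≤ 1)
    (hq2 : ∀ z, ‖z‖ ≤ 2 → q z = 1) (hq3 : ∀ z, 3 ≤ ‖z‖ → q z = 0) {f : ℂ → ℂ} {M α δ : ℝ}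
    (hM : 0 ≤ M) (hα : 0 < α) (hα1 : α < 1)
    (hf : ∀ z₁ z₂ : ℂ, ‖f z₁ - f z₂‖ ≤ M * ‖z₁ - z₂‖ ^ α) (hδ : 0 < δ) {κ : ℝ}
    (h : KyFanLE m (N₁ - N₂) κ) (hκ : 0 ≤ κ) (hN₁ : IsStarNormal N₁) (hN₂ : IsStarNormal N₂) :
    KyFanLE m (cfc f N₁ - cfc f N₂) (72 * 3 ^ α * M * δ ^ α *
      (m + (∫ ζ, ‖ζ‖ * ‖(𝓕 q) ζ‖) * (2 * Real.pi) * (2 ^ α + 2⁻¹) * (1 - 2 ^ (α - 1))⁻¹ *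
        (κ / δ))) := by
  have hfc := continuous_of_norm_sub_le_rpow hα hf
  set I := (∫ ζ, ‖ζ‖ * ‖(𝓕 q) ζ‖) with hI
  have hI0 : 0 ≤ I := MeasureTheory.integral_nonneg fun ζ => by positivity
  obtain ⟨R, hR⟩ := exists_int_norm_div_lt N₁ hδ
  set d : ℕ → ℝ := fun k => 2 ^ k * δ with hd
  have hd0 : ∀ k, 0 < d k := fun k => by positivity
  have hdR : ∀ k, ∀ z ∈ spectrum ℂ N₁, ‖z / d k‖ < R := fun k =>
    hR (d k) (le_mul_of_one_le_left hδ.le (one_le_pow₀ one_le_two))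
  set L : ℕ → (H →L[ℂ] H) → (H →L[ℂ] H) := fun k =>
    twoSided (latticeBox R) (latticeTent (d k)) (latticeTranslate q (d k)) N₁ N₂ with hL
  set G := cfc f N₁ - cfc f N₂ with hG
  set B : ℕ → ℝ := fun k => 72 * 3 ^ α * M * d k ^ α with hB
  set e : ℕ → ℝ := fun k => I * (2 * Real.pi * κ / d k) with he
  have he0 : ∀ k, 0 ≤ e k := fun k =>
    mul_nonneg hI0 (div_nonneg (mul_nonneg (by positivity) hκ) (hd0 k).le)
  have hE : ∀ k, KyFanLE m (1 - L k 1) (e k) := fun k =>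
    KyFanLE.one_sub_twoSided_one hq2 (hd0 k) h hκ hN₁ hN₂ (hdR k)
  have hcomm : ∀ k (E : H →L[ℂ] H) (c : ℝ), KyFanLE m E c → 0 ≤ c →
      KyFanLE m (L k (cfc f N₁ * E - E * cfc f N₂)) (B k * c) := fun k E c hEc hc =>
    hEc.twoSided_lattice_commutator hq1 hq3 hM hα.le hf hfc (hd0 k) hc hN₁ hN₂ (hdR k)
  have hone : KyFanLE m (1 : H →L[ℂ] H) (m * 1) :=
    KyFanLE.of_norm_le ContinuousLinearMap.norm_id_le
  have hL0 : KyFanLE m (L 0 G) (B 0 * m) := by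
    simpa [hG] using hcomm 0 1 _ hone (by positivity)
  have hdiff : ∀ k, KyFanLE m (L (k + 1) G - L k G) (B (k + 1) * e k + B k * e (k + 1)) := by
    intro k
    rw [hL, hG, twoSided_sub_twoSided _ _ _ _ _ _ _ hN₁ hN₂]
    exact (hcomm (k + 1) _ _ (hE k) (he0 k)).sub (hcomm k _ _ (hE (k + 1)) (he0 (k + 1)))
  have hend : ∀ k, KyFanLE m (G - L k G) (‖cfc f N₁‖ * 1 * e k + 1 * ‖cfc f N₂‖ * e k) := by
    intro k
    rw [hL, hG, sub_twoSided_sub _ _ _ _ hN₁ hN₂]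
    have h1 := (hE k).mul (cfc f N₁) 1 le_rfl ContinuousLinearMap.norm_id_le (he0 k)
    have h2 := (hE k).mul 1 (cfc f N₂) ContinuousLinearMap.norm_id_le le_rfl (he0 k)
    rw [mul_one] at h1
    rw [one_mul] at h2
    exact h1.sub h2
  have hr0 : (0 : ℝ) ≤ 2 ^ (α - 1) := by positivity
  have hr1 : (2 : ℝ) ^ (α - 1) < 1 := Real.rpow_lt_one_of_one_lt_of_neg one_lt_two (by linarith)
  have hterm : ∀ k, B (k + 1) * e k + B k * e (k + 1) = 72 * 3 ^ α * M * δ ^ α *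
      (I * (2 * Real.pi) * (2 ^ α + 2⁻¹) * (κ / δ)) * (2 ^ (α - 1)) ^ k := by
    intro k
    have h1 : ∀ j : ℕ, d j ^ α = ((2 : ℝ) ^ α) ^ j * δ ^ α := fun j => by
      rw [hd, Real.mul_rpow (by positivity) hδ.le, ← Real.rpow_natCast, ← Real.rpow_natCast,
        ← Real.rpow_mul (by norm_num), ← Real.rpow_mul (by norm_num), mul_comm α]
    have h2 : ((2 : ℝ) ^ (α - 1)) ^ k = ((2 : ℝ) ^ α) ^ k / 2 ^ k := by
      rw [Real.rpow_sub_one (by norm_num), div_pow]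
    simp only [hB, he]
    rw [h1, h1, h2, hd]
    field_simp
    ring
  have hsum : ∀ n, KyFanLE m (L n G) (72 * 3 ^ α * M * δ ^ α * (m + I * (2 * Real.pi) *
      (2 ^ α + 2⁻¹) * (1 - 2 ^ (α - 1))⁻¹ * (κ / δ))) := by
    intro n
    have h1 := hL0.add (KyFanLE.sum (Finset.range n) fun k _ => hdiff k)
    rw [Finset.sum_range_sub (fun k => L k G), add_sub_cancel] at h1
    refine h1.mono ?_
    simp_rw [hterm]
    rw [← Finset.mul_sum]
    have h2 : 0 ≤ 72 * 3 ^ α * M * δ ^ α * (I * (2 * Real.pi) * (2 ^ α + 2⁻¹) * (κ / δ)) := by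
      positivity
    have h3 := mul_le_mul_of_nonneg_left (sum_geometric_le hr0 hr1 n) h2
    have h4 : B 0 * m = 72 * 3 ^ α * M * δ ^ α * m := by simp [hB, hd]
    rw [h4]
    linarith
  have hlim : Filter.Tendsto e Filter.atTop (nhds 0) := by
    have h1 : e = fun k => I * (2 * Real.pi * κ / δ) * (1 / 2) ^ k := by
      ext k
      simp only [he, hd]
      rw [one_div, inv_pow]
      field_simp
    rw [h1]
    simpa using (tendsto_pow_atTop_nhds_zero_of_lt_one (by norm_num : (0 : ℝ) ≤ 1 / 2)
      (by norm_num)).const_mul (I * (2 * Real.pi * κ / δ))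
  refine KyFanLE.of_tendsto (F := fun _ => G) (c := fun n => 72 * 3 ^ α * M * δ ^ α *
    (m + I * (2 * Real.pi) * (2 ^ α + 2⁻¹) * (1 - 2 ^ (α - 1))⁻¹ * (κ / δ)) +
      (‖cfc f N₁‖ * 1 * e n + 1 * ‖cfc f N₂‖ * e n)) tendsto_const_nhds ?_
    (Filter.Eventually.of_forall fun n => ?_)
  · simpa using ((hlim.const_mul (‖cfc f N₁‖ * 1)).add
      (hlim.const_mul (1 * ‖cfc f N₂‖))).const_add (72 * 3 ^ α * M * δ ^ α *
        (m + I * (2 * Real.pi) * (2 ^ α + 2⁻¹) * (1 - 2 ^ (α - 1))⁻¹ * (κ / δ)))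
  · simpa using (hsum n).add (hend n)

/-- A constant for the bound of singular values by averages, in terms of a smooth cutoff `q`. -/
noncomputable def averageConst (q : 𝓢(ℂ, ℂ)) (α : ℝ) : ℝ :=
  72 * 3 ^ α * (1 + (∫ ζ, ‖ζ‖ * ‖(𝓕 q) ζ‖) * (2 * Real.pi) * (2 ^ α + 2⁻¹) *
    (1 - 2 ^ (α - 1))⁻¹)

lemma averageConst_pos (q : 𝓢(ℂ, ℂ)) {α : ℝ} (hα1 : α < 1) : 0 < averageConst q α := by
  have hI0 : 0 ≤ (∫ ζ, ‖ζ‖ * ‖(𝓕 q) ζ‖) := MeasureTheory.integral_nonneg fun ζ => by positivity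
  have hr1 : (2 : ℝ) ^ (α - 1) < 1 := Real.rpow_lt_one_of_one_lt_of_neg one_lt_two (by linarith)
  have h2 : 0 ≤ (1 - (2 : ℝ) ^ (α - 1))⁻¹ := inv_nonneg.2 (by linarith)
  unfold averageConst
  positivity

lemma sNum_cfc_sub_cfc_le_average {q : 𝓢(ℂ, ℂ)} (hq1 : ∀ z, ‖q z‖ ≤ 1)
    (hq2 : ∀ z, ‖z‖ ≤ 2 → q z = 1) (hq3 : ∀ z, 3 ≤ ‖z‖ → q z = 0) {f : ℂ → ℂ} {M α : ℝ}
    (hM : 0 ≤ M) (hα : 0 < α) (hα1 : α < 1)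
    (hf : ∀ z₁ z₂ : ℂ, ‖f z₁ - f z₂‖ ≤ M * ‖z₁ - z₂‖ ^ α) (hN₁ : IsStarNormal N₁)
    (hN₂ : IsStarNormal N₂) (m : ℕ) :
    sNum (cfc f N₁ - cfc f N₂) (2 * m) ≤ averageConst q α * M *
      ((∑ i ∈ Finset.range (m + 1), sNum (N₁ - N₂) i) / (m + 1 : ℕ)) ^ α := by
  set S := ∑ i ∈ Finset.range (m + 1), sNum (N₁ - N₂) i with hS
  have hS0 : 0 ≤ S := Finset.sum_nonneg fun i _ => sNum_nonneg _ _
  have hm : (0 : ℝ) < (m + 1 : ℕ) := by positivity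
  have key : ∀ ε : ℝ, 0 < ε → sNum (cfc f N₁ - cfc f N₂) (2 * m) ≤ averageConst q α * M *
      ((S + ε) / (m + 1 : ℕ)) ^ α := by
    intro ε hε
    have hδ : 0 < (S + ε) / (m + 1 : ℕ) := by positivity
    have h1 := KyFanLE.cfc_sub_cfc_of_holder hq1 hq2 hq3 hM hα hα1 hf hδ
      ((kyFanLE_sum_sNum (m + 1) (N₁ - N₂)).mono (by linarith : S ≤ S + ε)) (by positivity)
      hN₁ hN₂
    have h2 : (S + ε) / ((S + ε) / (m + 1 : ℕ)) = (m + 1 : ℕ) := by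
      field_simp
    rw [h2] at h1
    have h3 := (h1.mono (D := (m + 1 : ℕ) * (averageConst q α * M *
      ((S + ε) / (m + 1 : ℕ)) ^ α)) (le_of_eq (by rw [averageConst]; ring))).mul_sNum_le
      (by have := (averageConst_pos q hα1).le; positivity)
    exact le_of_mul_le_mul_left h3 hm
  have hcont : Continuous fun ε : ℝ => averageConst q α * M * ((S + ε) / (m + 1 : ℕ)) ^ α :=
    continuous_const.mul ((by fun_prop : Continuous fun ε : ℝ =>
      (S + ε) / (m + 1 : ℕ)).rpow_const fun _ => Or.inr hα.le)
  have hlim := (hcont.tendsto 0).mono_left (nhdsWithin_le_nhds (s := Set.Ioi 0))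
  simp only [add_zero] at hlim
  exact ge_of_tendsto hlim (Filter.eventually_of_mem self_mem_nhdsWithin fun ε hε => key ε hε)

end HolderEstimate

/-- Let `0 < α < 1` and `1 < p < ∞`. There is `c > 0` (depending only on `α, p`) such that
for every `f ∈ Λ_α(ℝ²)` with Hölder bound `M` (so `‖f‖_{Λ_α} ≤ M`) and all bounded normal
operators `N₁, N₂` with `N₁ - N₂ ∈ S_p`, one has `f(N₁) - f(N₂) ∈ S_{p/α}` and
`‖f(N₁) - f(N₂)‖_{S_{p/α}} ≤ c M ‖N₁ - N₂‖_{S_p}^α`. -/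
theorem holder_schatten :
    ∀ (α p : ℝ), 0 < α → α < 1 → 1 < p →
    ∃ c : ℝ, 0 < c ∧
      ∀ (f : ℂ → ℂ) (M : ℝ), 0 ≤ M →
      (∀ z₁ z₂ : ℂ, ‖f z₁ - f z₂‖ ≤ M * ‖z₁ - z₂‖ ^ α) →
      ∀ (H : Type*) [NormedAddCommGroup H] [InnerProductSpace ℂ H] [CompleteSpace H]
        (N₁ N₂ : H →L[ℂ] H), IsStarNormal N₁ → IsStarNormal N₂ →
        MemSchatten p (N₁ - N₂) →
        MemSchatten (p / α) (cfc f N₁ - cfc f N₂) ∧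
          schattenNorm (p / α) (cfc f N₁ - cfc f N₂) ≤
            c * M * schattenNorm p (N₁ - N₂) ^ α := by
  intro α p hα hα1 hp
  obtain ⟨q, hq1, hq2, hq3⟩ := exists_schwartzMap_bump
  have hc := averageConst_pos q hα1
  have hp1 : 0 < p - 1 := by linarith
  refine ⟨(2 * (2 ^ p / (p - 1))) ^ (α / p) * averageConst q α, by positivity, ?_⟩
  intro f M hM hf H _ _ _ N₁ N₂ hN₁ hN₂ hK
  exact memSchatten_of_sNum_le_average hα hp hc.le hM hK
    (sNum_cfc_sub_cfc_le_average hq1 hq2 hq3 hM hα hα1 hf hN₁ hN₂)
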